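/- arXiv:math/0608555 — 3 statements merged into one kernel-verified Lean document; each statement's English description precedes it below -/
import Mathlib

section
/- Let g : [−1, 1] → ℝ be a smooth function with 0.99 < g'(x) < 1.01 and |g''(x)| ≤ 1/2 for all x ∈ [−1, 1], and let u : ℝ → ℂ be a smooth function with compact support contained in the open interval (−1, 1). Then there exists a constant B > 0 (depending on g and u but independent of s and t) such that for all real numbers s, t with 1 ≤ t ≤ s, one has |∫_{−1}^{1} u(x) · |x|^{−1/2 − it} · e^{i·s·g(x)} dx| ≤ B · s^{−1/2}. -/
open MeasureTheory Real

lemma weight_bound {v τ t : ℝ} (hv : 0 ≤ v) (hτ : 0 ≤ τ) (ht : 1 ≤ |t|) (hτt : τ ^ 2 = |t|) :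
    (v ^ 2 + |v ^ 2 - t|) * (1 + (v - τ) ^ 2) ≤ 4 * (v ^ 2 + (v ^ 2 - t) ^ 2) := by
  have hy : (v - τ) ^ 2 ≤ |v ^ 2 - t| ∧ v ^ 2 * (v - τ) ^ 2 ≤ (v ^ 2 - t) ^ 2 := by
    have hvτ : 0 ≤ v * τ := mul_nonneg hv hτ
    rcases le_total 0 t with h | h
    · rw [abs_of_nonneg h] at hτt
      subst hτt
      constructor
      · have : |v - τ| ≤ v + τ := abs_le.2 ⟨by linarith, by linarith⟩
        rw [show v ^ 2 - τ ^ 2 = (v - τ) * (v + τ) by ring, abs_mul, abs_of_nonneg (add_nonneg hv hτ),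
          ← sq_abs, sq]
        gcongr
      · rw [show (v ^ 2 - τ ^ 2) ^ 2 = (v + τ) ^ 2 * (v - τ) ^ 2 by ring]
        gcongr
        linarith
    · rw [abs_of_nonpos h] at hτt
      obtain rfl : t = -τ ^ 2 := by linarith
      have : (v - τ) ^ 2 ≤ v ^ 2 - -τ ^ 2 := by nlinarith
      constructor
      · exact this.trans (le_abs_self _)
      · rw [sq (v ^ 2 - -τ ^ 2)]
        exact mul_le_mul (by nlinarith) this (sq_nonneg _) (by nlinarith)
  have hh : |v ^ 2 - t| ≤ v ^ 2 + 2 * (v ^ 2 - t) ^ 2 := by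
    rw [← sq_abs (v ^ 2 - t)]
    rcases le_total (1 / 2) |v ^ 2 - t| with h | h
    · nlinarith [sq_nonneg v]
    · have := abs_le.1 h
      rcases abs_cases t with h' | h' <;> nlinarith [sq_nonneg |v ^ 2 - t|, sq_nonneg v]
  have h2 : |v ^ 2 - t| * (v - τ) ^ 2 ≤ (v ^ 2 - t) ^ 2 := by
    rw [← sq_abs (v ^ 2 - t), sq |v ^ 2 - t|]
    gcongr
    exact hy.1
  nlinarith [sq_nonneg v]

lemma half_le_norm_denom {a h : ℝ} (ha : 0 ≤ a) :
    (a + h ^ 2) / 2 ≤ ‖(a : ℂ) + Complex.I * h ^ 2‖ := by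
  have h1 := Complex.abs_re_le_norm ((a : ℂ) + Complex.I * h ^ 2)
  have h2 := Complex.abs_im_le_norm ((a : ℂ) + Complex.I * h ^ 2)
  simp only [← Complex.ofReal_pow] at h1 h2 ⊢
  simp [-Complex.ofReal_pow, abs_of_nonneg ha] at h1 h2
  linarith

lemma norm_remainder_le {x s h p : ℝ} (hx : 0 < x) (hs : 0 < s) (hp : |p| ≤ 1.51) :
    ‖(x * s : ℂ) / (x * s + Complex.I * h ^ 2) + h / (2 * (x * s + Complex.I * h ^ 2))
      - ((h + x * (s * p)) / (x * s + Complex.I * h ^ 2)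
        - x * h * (s + Complex.I * (2 * h * (s * p))) / (x * s + Complex.I * h ^ 2) ^ 2)‖
      ≤ 12 * (x * s + |h|) / (x * s + h ^ 2) := by
  have hxs : 0 < x * s := mul_pos hx hs
  have hD := half_le_norm_denom (h := h) hxs.le
  have h1 := Complex.abs_re_le_norm (((x * s : ℝ) : ℂ) + Complex.I * h ^ 2)
  have h2 := Complex.abs_im_le_norm (((x * s : ℝ) : ℂ) + Complex.I * h ^ 2)
  push_cast at hD h1 h2
  set D : ℂ := x * s + Complex.I * h ^ 2 with hDdef
  have h1' : x * s ≤ ‖D‖ := by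
    refine le_trans ?_ h1
    simp [hDdef, ← Complex.ofReal_pow, abs_of_pos hx, abs_of_pos hs]
  have h2' : h ^ 2 ≤ ‖D‖ := by
    refine le_trans ?_ h2
    simp [hDdef, ← Complex.ofReal_pow]
  have hDpos : 0 < ‖D‖ := hxs.trans_le h1'
  have hD0 : D ≠ 0 := norm_pos_iff.1 hDpos
  have key : ‖(x * s : ℂ) / D + h / (2 * D) - ((h + x * (s * p)) / D
        - x * h * (s + Complex.I * (2 * h * (s * p))) / D ^ 2)‖ ≤ 6 * (x * s + |h|) / ‖D‖ := by
    have e : (x * s : ℂ) / D + h / (2 * D) - ((h + x * (s * p)) / D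
        - x * h * (s + Complex.I * (2 * h * (s * p))) / D ^ 2)
        = (((x * s * (1 - p) - h / 2 : ℝ) : ℂ) + ((x * s * h : ℝ) : ℂ) / D
          + Complex.I * ((2 * (h ^ 2) * (x * s * p) : ℝ) : ℂ) / D) / D := by
      push_cast
      field_simp
      ring
    rw [e, norm_div]
    gcongr
    refine (norm_add₃_le).trans ?_
    rw [norm_div, norm_div, norm_mul, Complex.norm_I, one_mul, Complex.norm_real,
      Complex.norm_real, Complex.norm_real, Real.norm_eq_abs, Real.norm_eq_abs, Real.norm_eq_abs]
    have b2 : |x * s * h| / ‖D‖ ≤ |h| := by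
      rw [div_le_iff₀ hDpos, abs_mul, abs_of_pos hxs, mul_comm]
      gcongr
    have b3 : |2 * h ^ 2 * (x * s * p)| / ‖D‖ ≤ 2 * (x * s * 1.51) := by
      rw [div_le_iff₀ hDpos, abs_mul, abs_mul, abs_mul, abs_of_pos hxs, abs_of_nonneg (sq_nonneg h),
        abs_two]
      calc 2 * h ^ 2 * (x * s * |p|) ≤ 2 * ‖D‖ * (x * s * 1.51) := by gcongr
        _ = _ := by ring
    have b1 : |x * s * (1 - p) - h / 2| ≤ x * s * 2.51 + |h| / 2 := by
      refine (abs_sub _ _).trans ?_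
      rw [abs_mul, abs_of_pos hxs, abs_div, abs_two]
      gcongr
      exact (abs_sub _ _).trans (by rw [abs_one]; linarith)
    have := abs_nonneg h
    linarith
  refine key.trans ?_
  rw [div_le_div_iff₀ hDpos (by positivity)]
  have : 0 ≤ x * s + |h| := by positivity
  nlinarith

lemma norm_cpow_exp {x t s y : ℝ} (hx : 0 < x) :
    ‖Complex.exp ((-(1 / 2) - Complex.I * (t : ℂ)) * (Real.log x : ℂ)) *
      Complex.exp (Complex.I * (s : ℂ) * (y : ℂ))‖ = (√x)⁻¹ := by
  rw [norm_mul, Complex.norm_exp, Complex.norm_exp]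
  have : Real.exp (-(1/2) * Real.log x) = (√x)⁻¹ := by
    rw [Real.sqrt_eq_rpow, ← Real.rpow_neg hx.le, Real.rpow_def_of_pos hx]
    ring_nf
  rw [← this]
  simp

lemma hasDerivAt_oscillation {g : ℝ → ℝ} {g₁ x s t : ℝ} (hx : 0 < x) (hg : HasDerivAt g g₁ x) :
    HasDerivAt (fun x : ℝ => Complex.exp ((-(1 / 2) - Complex.I * (t : ℂ)) * (Real.log x : ℂ)) *
      Complex.exp (Complex.I * (s : ℂ) * (g x : ℂ)))
      (Complex.exp ((-(1 / 2) - Complex.I * (t : ℂ)) * (Real.log x : ℂ)) *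
        Complex.exp (Complex.I * (s : ℂ) * (g x : ℂ)) *
        ((-(1 / 2) + Complex.I * ((s * x * g₁ - t : ℝ) : ℂ)) / x)) x := by
  have h1 := (((Real.hasDerivAt_log hx.ne').ofReal_comp).const_mul
    (-(1 / 2) - Complex.I * (t : ℂ))).cexp
  have h2 := ((hg.ofReal_comp).const_mul (Complex.I * (s : ℂ))).cexp
  refine (h1.mul h2).congr_deriv ?_
  have : (x : ℂ) ≠ 0 := by exact_mod_cast hx.ne'
  push_cast
  field_simp
  ring

lemma hasDerivAt_multiplier {g₁ : ℝ → ℝ} {g₂ x s t : ℝ} (hx : 0 < x) (hs : 0 < s)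
    (hg : HasDerivAt g₁ g₂ x) :
    HasDerivAt (fun x : ℝ => (x * ((s * x * g₁ x - t : ℝ) : ℂ)) /
        (x * s + Complex.I * ((s * x * g₁ x - t : ℝ) : ℂ) ^ 2))
      ((((s * x * g₁ x - t : ℝ) : ℂ) + x * (s * ((g₁ x + x * g₂ : ℝ) : ℂ))) /
          (x * s + Complex.I * ((s * x * g₁ x - t : ℝ) : ℂ) ^ 2)
        - x * ((s * x * g₁ x - t : ℝ) : ℂ) *
            (s + Complex.I * (2 * ((s * x * g₁ x - t : ℝ) : ℂ) *
              (s * ((g₁ x + x * g₂ : ℝ) : ℂ)))) /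
          (x * s + Complex.I * ((s * x * g₁ x - t : ℝ) : ℂ) ^ 2) ^ 2) x := by
  have hD : (x * s + Complex.I * ((s * x * g₁ x - t : ℝ) : ℂ) ^ 2) ≠ 0 := by
    have := half_le_norm_denom (h := s * x * g₁ x - t) (mul_pos hx hs).le
    rw [Complex.ofReal_mul] at this
    exact norm_pos_iff.1 (lt_of_lt_of_le (by positivity) this)
  have hid : HasDerivAt (fun x : ℝ => (x : ℂ)) 1 x := (hasDerivAt_id x).ofReal_comp
  have hh : HasDerivAt (fun x : ℝ => ((s * x * g₁ x - t : ℝ) : ℂ))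
      ((s * (g₁ x + x * g₂) : ℝ) : ℂ) x := by
    refine HasDerivAt.ofReal_comp ?_
    refine ((((hasDerivAt_id x).const_mul s).mul hg).sub_const t).congr_deriv ?_
    simp only [id]
    ring
  refine ((hid.mul hh).div ((hid.mul_const (s : ℂ)).add ((hh.pow 2).const_mul Complex.I))
    hD).congr_deriv ?_
  simp only [Pi.mul_apply, Pi.add_apply, Pi.pow_apply]
  generalize ((s * x * g₁ x - t : ℝ) : ℂ) = h at hD ⊢
  push_cast
  field_simp

lemma norm_multiplier_le {x s h : ℝ} (hx : 0 < x) (hs : 0 < s) :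
    (√x)⁻¹ * ‖(x * h : ℂ) / (x * s + Complex.I * h ^ 2)‖ ≤ (√s)⁻¹ := by
  have hD := half_le_norm_denom (h := h) (mul_pos hx hs).le
  have hpos := lt_of_lt_of_le (by positivity : 0 < (x * s + h ^ 2) / 2) hD
  rw [Complex.ofReal_mul] at hD hpos
  rw [norm_div, norm_mul, Complex.norm_real, Complex.norm_real, Real.norm_eq_abs, Real.norm_eq_abs,
    abs_of_pos hx, ← div_eq_inv_mul, div_div, div_le_iff₀ (by positivity), inv_mul_eq_div,
    le_div_iff₀ (by positivity)]
  have h1 : x = √x ^ 2 := (Real.sq_sqrt hx.le).symm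
  have h2 : s = √s ^ 2 := (Real.sq_sqrt hs.le).symm
  have h3 : √x * √s * |h| ≤ (x * s + h ^ 2) / 2 := by
    nlinarith [sq_nonneg (√x * √s - |h|), sq_abs h]
  calc x * |h| * √s = √x * (√x * √s * |h|) := by nth_rewrite 1 [h1]; ring
    _ ≤ √x * ‖(x * s : ℂ) + Complex.I * h ^ 2‖ := by
      gcongr
      exact h3.trans hD
    _ = _ := by ring

lemma remainder_le_deriv_arctan {x s t γ p : ℝ} (hx : 0 < x) (hs : 0 < s) (ht : 1 ≤ |t|)
    (hγ : 0.99 < γ ∧ γ < 1.01) (hp : 0.49 ≤ p) :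
    (√x)⁻¹ * (12 * (x * s + |s * x * γ - t|) / (x * s + (s * x * γ - t) ^ 2)) ≤
      300 * (√s)⁻¹ * (1 / (1 + (√(s * x * γ) - √|t|) ^ 2) * (s * p / (2 * √(s * x * γ)))) := by
  have hγ0 : 0 < γ := by linarith [hγ.1]
  have hxs : 0 < x * s := mul_pos hx hs
  have hv2 : √(s * x * γ) ^ 2 = s * x * γ := Real.sq_sqrt (by positivity)
  have hv : 0 < √(s * x * γ) := Real.sqrt_pos.2 (by positivity)
  have key := weight_bound hv.le (Real.sqrt_nonneg |t|) ht (Real.sq_sqrt (abs_nonneg t))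
  rw [hv2] at key
  have hvle : √(s * x * γ) ≤ 1.01 * (√s * √x) := by
    rw [Real.sqrt_le_left (by positivity), mul_pow, mul_pow, Real.sq_sqrt hs.le,
      Real.sq_sqrt hx.le]
    nlinarith [hγ.2]
  set v := √(s * x * γ)
  set h := s * x * γ - t
  set Y := 1 + (v - √|t|) ^ 2
  have hY : 0 < Y := by positivity
  have h1 : 12 * (x * s + |h|) / (x * s + h ^ 2) ≤ 49.2 / Y := by
    rw [div_le_div_iff₀ (by positivity) hY]
    have h3 : 0.99 * (x * s + |h|) ≤ s * x * γ + |h| := by nlinarith [hγ.1, abs_nonneg h]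
    have h4 : s * x * γ + h ^ 2 ≤ 1.01 * (x * s + h ^ 2) := by nlinarith [hγ.2, sq_nonneg h]
    have h5 : 0.99 * (x * s + |h|) * Y ≤ (s * x * γ + |h|) * Y := by gcongr
    have h6 : 0 < x * s + h ^ 2 := by positivity
    linarith
  have hsx : 0 < √x := Real.sqrt_pos.2 hx
  have hss : 0 < √s := Real.sqrt_pos.2 hs
  calc _ ≤ (√x)⁻¹ * (49.2 / Y) := by gcongr
    _ = 49.2 * (√x)⁻¹ * (1 / Y) := by ring
    _ ≤ 300 * √s * p / (2 * v) * (1 / Y) := by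
      gcongr
      rw [← div_eq_mul_inv, div_le_div_iff₀ hsx (by positivity)]
      have : 0 < √s * √x := by positivity
      nlinarith
    _ = _ := by
      have : s = √s * √s := (Real.mul_self_sqrt hs.le).symm
      nth_rewrite 3 [this]
      field_simp

/-- The derivative of the main term in the integration by parts, and the bound for what is left. -/
lemma exists_hasDerivAt_norm_sub_le {g g₁ : ℝ → ℝ} {u : ℝ → ℂ} {u' : ℂ} {g₂ x s t M : ℝ}
    (hx : x ∈ Set.Ioo (0 : ℝ) 1) (hs : 0 < s) (ht : 1 ≤ |t|)
    (hg : HasDerivAt g (g₁ x) x) (hg₁ : HasDerivAt g₁ g₂ x)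
    (hγ : 0.99 < g₁ x ∧ g₁ x < 1.01) (hg₂ : |g₂| ≤ 1 / 2)
    (hu : HasDerivAt u u' x) (huM : ‖u x‖ ≤ M) (huM' : ‖u'‖ ≤ M) :
    ∃ G' : ℂ, HasDerivAt (fun x : ℝ =>
        u x * (Complex.exp ((-(1 / 2) - Complex.I * (t : ℂ)) * (Real.log x : ℂ)) *
          Complex.exp (Complex.I * (s : ℂ) * (g x : ℂ))) *
        ((x * ((s * x * g₁ x - t : ℝ) : ℂ)) /
          (x * s + Complex.I * ((s * x * g₁ x - t : ℝ) : ℂ) ^ 2))) G' x ∧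
      ‖u x * (Complex.exp ((-(1 / 2) - Complex.I * (t : ℂ)) * (Real.log x : ℂ)) *
          Complex.exp (Complex.I * (s : ℂ) * (g x : ℂ))) - G'‖ ≤
        M * (300 * (√s)⁻¹ * (1 / (1 + (√(s * x * g₁ x) - √|t|) ^ 2) *
          (s * (g₁ x + x * g₂) / (2 * √(s * x * g₁ x)))) + (√s)⁻¹) := by
  obtain ⟨hx0, hx1⟩ := hx
  have hM : 0 ≤ M := (norm_nonneg _).trans huM
  refine ⟨_, (hu.mul (hasDerivAt_oscillation hx0 hg)).mul (hasDerivAt_multiplier hx0 hs hg₁), ?_⟩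
  have hE := norm_cpow_exp (t := t) (s := s) (y := g x) hx0
  have hm := norm_multiplier_le (h := s * x * g₁ x - t) hx0 hs
  have hp : 0.49 ≤ g₁ x + x * g₂ ∧ |g₁ x + x * g₂| ≤ 1.51 := by
    have h1 : |x * g₂| ≤ 1 / 2 := by
      rw [abs_mul, abs_of_pos hx0]
      nlinarith [abs_nonneg g₂]
    have := abs_le.1 h1
    exact ⟨by linarith [hγ.1], abs_le.2 ⟨by linarith [hγ.1], by linarith [hγ.2]⟩⟩
  have hr := norm_remainder_le (h := s * x * g₁ x - t) hx0 hs hp.2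
  have hw := remainder_le_deriv_arctan hx0 hs ht hγ hp.1
  have hD : (x * s + Complex.I * ((s * x * g₁ x - t : ℝ) : ℂ) ^ 2) ≠ 0 := by
    have := half_le_norm_denom (h := s * x * g₁ x - t) (mul_pos hx0 hs).le
    rw [Complex.ofReal_mul] at this
    exact norm_pos_iff.1 (lt_of_lt_of_le (by positivity) this)
  have hxc : (x : ℂ) ≠ 0 := by exact_mod_cast hx0.ne'
  simp only [Pi.mul_apply]
  set E := Complex.exp ((-(1 / 2) - Complex.I * (t : ℂ)) * (Real.log x : ℂ)) *
          Complex.exp (Complex.I * (s : ℂ) * (g x : ℂ)) with hEdef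
  set h : ℂ := ((s * x * g₁ x - t : ℝ) : ℂ) with hh
  set D : ℂ := x * s + Complex.I * h ^ 2 with hDdef
  set q' : ℂ := (h + x * (s * ((g₁ x + x * g₂ : ℝ) : ℂ))) / D -
    x * h * (s + Complex.I * (2 * h * (s * ((g₁ x + x * g₂ : ℝ) : ℂ)))) / D ^ 2
  have e : u x * E - ((u' * E + u x * (E * ((-(1 / 2) + Complex.I * h) / x))) * (x * h / D)
        + u x * E * q') =
      u x * (E * (x * s / D + h / (2 * D) - q')) - u' * (E * (x * h / D)) := by
    have : (1 : ℂ) = x * s / D + Complex.I * h ^ 2 / D := by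
      rw [← add_div, div_self hD]
    have h2 : u x * E = u x * E * (x * s / D + Complex.I * h ^ 2 / D) := by rw [← this, mul_one]
    rw [h2]
    field_simp
    ring
  rw [e]
  refine (norm_sub_le _ _).trans ?_
  rw [mul_add M, norm_mul, norm_mul u', norm_mul E, norm_mul E, hE]
  exact add_le_add (mul_le_mul huM ((mul_le_mul_of_nonneg_left hr (by positivity)).trans hw) (by positivity) hM)
    (mul_le_mul huM' hm (by positivity) hM)

lemma intervalIntegrable_rpow_neg_half (a b : ℝ) :
    IntervalIntegrable (fun x : ℝ => x ^ (-(1 / 2) : ℝ)) volume a b :=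
  intervalIntegral.intervalIntegrable_rpow' (by norm_num)

/-- The bound away from the origin. -/
lemma norm_integral_oscillation_Icc_le {g g₁ g₂ : ℝ → ℝ} {u u₁ : ℝ → ℂ} {s t M a b : ℝ}
    (ha : 0 < a) (hab : a ≤ b) (hb : b < 1) (hs : 0 < s) (ht : 1 ≤ |t|)
    (hg : ∀ x ∈ Set.Ioo (0 : ℝ) 1, HasDerivAt g (g₁ x) x)
    (hg₁ : ∀ x ∈ Set.Ioo (0 : ℝ) 1, HasDerivAt g₁ (g₂ x) x)
    (hγ : ∀ x ∈ Set.Ioo (0 : ℝ) 1, 0.99 < g₁ x ∧ g₁ x < 1.01)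
    (hg₂ : ∀ x ∈ Set.Ioo (0 : ℝ) 1, |g₂ x| ≤ 1 / 2)
    (hu : ∀ x ∈ Set.Ioo (0 : ℝ) 1, HasDerivAt u (u₁ x) x)
    (huM : ∀ x ∈ Set.Ioo (0 : ℝ) 1, ‖u x‖ ≤ M)
    (huM' : ∀ x ∈ Set.Ioo (0 : ℝ) 1, ‖u₁ x‖ ≤ M) :
    ‖∫ x in a..b, u x * (Complex.exp ((-(1 / 2) - Complex.I * (t : ℂ)) * (Real.log x : ℂ)) *
          Complex.exp (Complex.I * (s : ℂ) * (g x : ℂ)))‖ ≤ 1203 * M * (√s)⁻¹ := by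
  have hsub : Set.Icc a b ⊆ Set.Ioo 0 1 := fun x hx => ⟨ha.trans_le hx.1, hx.2.trans_lt hb⟩
  set f : ℝ → ℂ := fun x => u x *
    (Complex.exp ((-(1 / 2) - Complex.I * (t : ℂ)) * (Real.log x : ℂ)) *
      Complex.exp (Complex.I * (s : ℂ) * (g x : ℂ))) with hf
  have hfc : ContinuousOn f (Set.Ioo 0 1) := fun x hx =>
    ((hu x hx).mul (hasDerivAt_oscillation hx.1 (hg x hx))).continuousAt.continuousWithinAt
  have hfi : IntervalIntegrable f volume a b :=
    (hfc.mono (by rwa [Set.uIcc_of_le hab])).intervalIntegrable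
  have hM : 0 ≤ M := (norm_nonneg _).trans (huM b (hsub ⟨hab, le_rfl⟩))
  choose! G' hG hG' using fun x (hx : x ∈ Set.Ioo (0 : ℝ) 1) =>
    exists_hasDerivAt_norm_sub_le hx hs ht (hg x hx) (hg₁ x hx) (hγ x hx) (hg₂ x hx) (hu x hx)
      (huM x hx) (huM' x hx)
  set G : ℝ → ℂ := fun x => u x *
    (Complex.exp ((-(1 / 2) - Complex.I * (t : ℂ)) * (Real.log x : ℂ)) *
      Complex.exp (Complex.I * (s : ℂ) * (g x : ℂ))) *
    ((x * ((s * x * g₁ x - t : ℝ) : ℂ)) /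
      (x * s + Complex.I * ((s * x * g₁ x - t : ℝ) : ℂ) ^ 2)) with hGdef
  have hGle : ∀ x ∈ Set.Ioo (0 : ℝ) 1, ‖G x‖ ≤ M * (√s)⁻¹ := fun x hx => by
    rw [hGdef]
    simp only []
    rw [mul_assoc, norm_mul, norm_mul (Complex.exp _ * _), norm_cpow_exp hx.1]
    exact mul_le_mul (huM x hx) (norm_multiplier_le hx.1 hs) (by positivity) hM
  set P : ℝ → ℝ := fun x => M * (300 * (√s)⁻¹ * Real.arctan (√(s * x * g₁ x) - √|t|) +
    (√s)⁻¹ * x) with hP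
  have hPd : ∀ x ∈ Set.Ioo (0 : ℝ) 1, HasDerivAt P (M * (300 * (√s)⁻¹ *
      (1 / (1 + (√(s * x * g₁ x) - √|t|) ^ 2) *
        (s * (g₁ x + x * g₂ x) / (2 * √(s * x * g₁ x)))) + (√s)⁻¹)) x := fun x hx => by
    have hpos : s * x * g₁ x ≠ 0 :=
      (mul_pos (mul_pos hs hx.1) (by linarith [(hγ x hx).1])).ne'
    have h1 : HasDerivAt (fun x => s * x * g₁ x) (s * (g₁ x + x * g₂ x)) x := by
      refine (((hasDerivAt_id x).const_mul s).mul (hg₁ x hx)).congr_deriv ?_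
      simp only [id]
      ring
    refine (((((h1.sqrt hpos).sub_const _).arctan.const_mul (300 * (√s)⁻¹)).add
      ((hasDerivAt_id x).const_mul (√s)⁻¹)).const_mul M).congr_deriv ?_
    ring
  have hFd : ∀ x ∈ Set.Icc a b, HasDerivAt (fun x => (∫ y in a..x, f y) - (G x - G a))
      (f x - G' x) x := fun x hx => by
    refine HasDerivAt.sub ?_ ((hG x (hsub hx)).sub_const _)
    exact intervalIntegral.integral_hasDerivAt_right
      (hfi.mono_set (by
        rw [Set.uIcc_of_le hab, Set.uIcc_of_le hx.1]; exact Set.Icc_subset_Icc_right hx.2))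
      (hfc.stronglyMeasurableAtFilter isOpen_Ioo x (hsub hx))
      (hfc.continuousAt (isOpen_Ioo.mem_nhds (hsub hx)))
  have main := image_norm_le_of_norm_deriv_right_le_deriv_boundary'
    (f := fun x => (∫ y in a..x, f y) - (G x - G a)) (f' := fun x => f x - G' x)
    (B := fun x => P x - P a) (a := a) (b := b)
    (fun x hx => (hFd x hx).continuousAt.continuousWithinAt)
    (fun x hx => (hFd x ⟨hx.1, hx.2.le⟩).hasDerivWithinAt) (by simp)
    (fun x hx => ((hPd x (hsub hx)).sub_const _).continuousAt.continuousWithinAt)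
    (fun x hx => ((hPd x (hsub ⟨hx.1, hx.2.le⟩)).sub_const _).hasDerivWithinAt)
    (fun x hx => hG' x (hsub ⟨hx.1, hx.2.le⟩)) (Set.right_mem_Icc.2 hab)
  have hPab : P b - P a ≤ M * (1201 * (√s)⁻¹) := by
    have h1 := Real.arctan_lt_pi_div_two (√(s * b * g₁ b) - √|t|)
    have h2 := Real.neg_pi_div_two_lt_arctan (√(s * a * g₁ a) - √|t|)
    have h3 := Real.pi_le_four
    have h4 : 0 ≤ (√s)⁻¹ := by positivity
    rw [hP]
    simp only []
    rw [← mul_sub]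
    gcongr
    nlinarith
  have e : ∫ y in a..b, f y = ((∫ y in a..b, f y) - (G b - G a)) + G b - G a := by ring
  rw [e]
  refine (norm_sub_le _ _).trans ((add_le_add_left (norm_add_le _ _) _).trans ?_)
  have h1 := hGle b (hsub ⟨hab, le_rfl⟩)
  have h2 := hGle a (hsub ⟨le_rfl, hab⟩)
  linarith

/-- The bound on `(0, 1)`, for either sign of `t`. -/
lemma norm_integral_oscillation_le {g g₁ g₂ : ℝ → ℝ} {u u₁ : ℝ → ℂ} {s t M : ℝ}
    (hs : 1 ≤ s) (ht : 1 ≤ |t|)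
    (hg : ∀ x ∈ Set.Ioo (0 : ℝ) 1, HasDerivAt g (g₁ x) x)
    (hg₁ : ∀ x ∈ Set.Ioo (0 : ℝ) 1, HasDerivAt g₁ (g₂ x) x)
    (hγ : ∀ x ∈ Set.Ioo (0 : ℝ) 1, 0.99 < g₁ x ∧ g₁ x < 1.01)
    (hg₂ : ∀ x ∈ Set.Ioo (0 : ℝ) 1, |g₂ x| ≤ 1 / 2)
    (hu : ∀ x ∈ Set.Ioo (0 : ℝ) 1, HasDerivAt u (u₁ x) x)
    (huM : ∀ x ∈ Set.Ioo (0 : ℝ) 1, ‖u x‖ ≤ M)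
    (huM' : ∀ x ∈ Set.Ioo (0 : ℝ) 1, ‖u₁ x‖ ≤ M) :
    IntervalIntegrable (fun x => u x *
      (Complex.exp ((-(1 / 2) - Complex.I * (t : ℂ)) * (Real.log x : ℂ)) *
          Complex.exp (Complex.I * (s : ℂ) * (g x : ℂ)))) volume 0 1 ∧
    ‖∫ x in (0 : ℝ)..1, u x *
      (Complex.exp ((-(1 / 2) - Complex.I * (t : ℂ)) * (Real.log x : ℂ)) *
          Complex.exp (Complex.I * (s : ℂ) * (g x : ℂ)))‖ ≤ 1205 * M * (√s)⁻¹ := by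
  have hs0 : 0 < s := by linarith
  have hM : 0 ≤ M := (norm_nonneg _).trans (huM (1 / 2) (by norm_num))
  have hosc := fun a b ha hab hb => norm_integral_oscillation_Icc_le (a := a) (b := b)
    ha hab hb hs0 ht hg hg₁ hγ hg₂ hu huM huM'
  set f : ℝ → ℂ := fun x => u x *
    (Complex.exp ((-(1 / 2) - Complex.I * (t : ℂ)) * (Real.log x : ℂ)) *
      Complex.exp (Complex.I * (s : ℂ) * (g x : ℂ))) with hf
  have hfc : ContinuousOn f (Set.Ioo 0 1) := fun x hx =>
    ((hu x hx).mul (hasDerivAt_oscillation hx.1 (hg x hx))).continuousAt.continuousWithinAt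
  have hfn : ∀ x ∈ Set.Ioo (0 : ℝ) 1, ‖f x‖ ≤ M * x ^ (-(1 / 2) : ℝ) := fun x hx => by
    rw [hf]
    simp only []
    rw [norm_mul, norm_cpow_exp hx.1, Real.rpow_neg hx.1.le, ← Real.sqrt_eq_rpow]
    gcongr
    exact huM x hx
  have hfi : IntervalIntegrable f volume 0 1 := by
    rw [intervalIntegrable_iff_integrableOn_Ioo_of_le zero_le_one]
    refine Integrable.mono' (g := fun x => M * x ^ (-(1 / 2) : ℝ)) ?_
      (hfc.aestronglyMeasurable measurableSet_Ioo) ?_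
    · have := (intervalIntegrable_rpow_neg_half 0 1).const_mul M
      rwa [intervalIntegrable_iff_integrableOn_Ioo_of_le zero_le_one] at this
    · exact (ae_restrict_iff' measurableSet_Ioo).2 (.of_forall hfn)
  refine ⟨hfi, ?_⟩
  have hlt : ∀ b ∈ Set.Ioo (0 : ℝ) 1, ‖∫ x in (0 : ℝ)..b, f x‖ ≤ 1205 * M * (√s)⁻¹ := by
    intro b hb
    have ha : 0 < min b s⁻¹ := lt_min hb.1 (inv_pos.2 hs0)
    have hab : min b s⁻¹ ≤ b := min_le_left _ _
    have has : √(min b s⁻¹) ≤ (√s)⁻¹ := by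
      rw [← Real.sqrt_inv]
      exact Real.sqrt_le_sqrt (min_le_right _ _)
    set a := min b s⁻¹
    have h1 : ‖∫ x in (0 : ℝ)..a, f x‖ ≤ 2 * M * √a := by
      have : ‖∫ x in (0 : ℝ)..a, f x‖ ≤ ∫ x in (0 : ℝ)..a, M * x ^ (-(1 / 2) : ℝ) :=
        intervalIntegral.norm_integral_le_of_norm_le ha.le
          (.of_forall fun x hx => hfn x ⟨hx.1, (hx.2.trans hab).trans_lt hb.2⟩)
          ((intervalIntegrable_rpow_neg_half 0 a).const_mul M)
      refine this.trans_eq ?_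
      rw [intervalIntegral.integral_const_mul, integral_rpow (.inl (by norm_num)),
        Real.sqrt_eq_rpow, Real.zero_rpow (by norm_num)]
      norm_num
      ring
    have hsub : ∀ c ∈ Set.Icc (0 : ℝ) 1, IntervalIntegrable f volume 0 c := fun c hc =>
      hfi.mono_set (by
        rw [Set.uIcc_of_le zero_le_one, Set.uIcc_of_le hc.1]; exact Set.Icc_subset_Icc_right hc.2)
    have i1 := hsub a ⟨ha.le, hab.trans hb.2.le⟩
    have i2 := hsub b ⟨hb.1.le, hb.2.le⟩
    rw [← intervalIntegral.integral_add_adjacent_intervals i1 (i1.symm.trans i2)]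
    refine (norm_add_le _ _).trans ?_
    have h2 := hosc a b ha hab hb.2
    have h3 : 2 * M * √a ≤ 2 * M * (√s)⁻¹ := by gcongr
    linarith
  have hcont := intervalIntegral.continuousOn_primitive_interval
    ((intervalIntegrable_iff_integrableOn_Icc_of_le zero_le_one).1 hfi |>.mono_set
      (Set.uIcc_of_le (zero_le_one' ℝ)).le) |>.norm
  rw [Set.uIcc_of_le zero_le_one] at hcont
  have hmem : (1 : ℝ) ∈ closure (Set.Ioo (0 : ℝ) 1) := by
    rw [closure_Ioo zero_ne_one]
    exact Set.right_mem_Icc.2 zero_le_one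
  have := mem_closure_iff_nhdsWithin_neBot.1 hmem
  exact le_of_tendsto ((hcont 1 (Set.right_mem_Icc.2 zero_le_one)).mono Set.Ioo_subset_Icc_self)
    (eventually_mem_nhdsWithin.mono hlt)

/-- Uniform oscillatory-integral bound: for smooth `g` on `[-1,1]` with
`0.99 < g' < 1.01`, `|g''| ≤ 1/2`, and smooth `u` supported in `(-1,1)`,
`|∫_{-1}^1 u(x) |x|^{-1/2-it} e^{isg(x)} dx| ≤ B s^{-1/2}` uniformly for `1 ≤ t ≤ s`. -/
theorem stmt_2 (g : ℝ → ℝ) (hg : ContDiffOn ℝ (⊤ : ℕ∞) g (Set.Icc (-1) 1))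
    (hg' : ∀ x ∈ Set.Icc (-1 : ℝ) 1, 0.99 < deriv g x ∧ deriv g x < 1.01)
    (hg'' : ∀ x ∈ Set.Icc (-1 : ℝ) 1, |deriv (deriv g) x| ≤ 1 / 2)
    (u : ℝ → ℂ) (hu : ContDiff ℝ (⊤ : ℕ∞) u)
    (hsupp : tsupport u ⊆ Set.Ioo (-1) 1) :
    ∃ B : ℝ, 0 < B ∧ ∀ s t : ℝ, 1 ≤ t → t ≤ s →
      ‖∫ x in (-1 : ℝ)..1,
          u x * Complex.exp ((-(1 / 2) - Complex.I * (t : ℂ)) * (Real.log |x| : ℂ)) *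
            Complex.exp (Complex.I * (s : ℂ) * (g x : ℂ))‖ ≤ B * s ^ (-(1 / 2) : ℝ) := by
  have hgd : ∀ x ∈ Set.Ioo (-1 : ℝ) 1,
      HasDerivAt g (deriv g x) x ∧ HasDerivAt (deriv g) (deriv (deriv g) x) x := fun x hx => by
    have h1 : ContDiffOn ℝ (⊤ : ℕ∞) g (Set.Ioo (-1) 1) := hg.mono Set.Ioo_subset_Icc_self
    have h2 : ContDiffOn ℝ 1 (deriv g) (Set.Ioo (-1) 1) :=
      h1.deriv_of_isOpen isOpen_Ioo (WithTop.coe_le_coe.2 le_top)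
    have hn := isOpen_Ioo.mem_nhds hx
    exact ⟨((h1.differentiableOn (by simp)).differentiableAt hn).hasDerivAt,
      ((h2.differentiableOn (by simp)).differentiableAt hn).hasDerivAt⟩
  have hud : ∀ x, HasDerivAt u (deriv u x) x := fun x =>
    ((hu.differentiable (by simp)) x).hasDerivAt
  obtain ⟨M₀, hM₀⟩ := isCompact_Icc.exists_bound_of_continuousOn
    (hu.continuous.continuousOn (s := Set.Icc (-1 : ℝ) 1))
  obtain ⟨M₁, hM₁⟩ := isCompact_Icc.exists_bound_of_continuousOn
    ((hu.continuous_deriv (by simp)).continuousOn (s := Set.Icc (-1 : ℝ) 1))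
  set M := max 1 (max M₀ M₁)
  have hM0 : ∀ x ∈ Set.Icc (-1 : ℝ) 1, ‖u x‖ ≤ M := fun x hx =>
    (hM₀ x hx).trans ((le_max_left _ _).trans (le_max_right _ _))
  have hM1 : ∀ x ∈ Set.Icc (-1 : ℝ) 1, ‖deriv u x‖ ≤ M := fun x hx =>
    (hM₁ x hx).trans ((le_max_right _ _).trans (le_max_right _ _))
  have hM : 0 < M := lt_of_lt_of_le one_pos (le_max_left _ _)
  refine ⟨2410 * M, by positivity, fun s t ht hts => ?_⟩
  have hs : 1 ≤ s := ht.trans hts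
  have pos : ∀ x ∈ Set.Ioo (0 : ℝ) 1, x ∈ Set.Ioo (-1 : ℝ) 1 := fun x hx =>
    ⟨by linarith [hx.1], hx.2⟩
  have neg : ∀ x ∈ Set.Ioo (0 : ℝ) 1, -x ∈ Set.Ioo (-1 : ℝ) 1 := fun x hx =>
    ⟨by linarith [hx.2], by linarith [hx.1]⟩
  have sub : Set.Ioo (-1 : ℝ) 1 ⊆ Set.Icc (-1) 1 := Set.Ioo_subset_Icc_self
  obtain ⟨i1, h1⟩ := norm_integral_oscillation_le (t := t) hs (by rwa [abs_of_pos (by linarith)])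
    (fun x hx => (hgd x (pos x hx)).1) (fun x hx => (hgd x (pos x hx)).2)
    (fun x hx => hg' x (sub (pos x hx))) (fun x hx => hg'' x (sub (pos x hx)))
    (fun x _ => hud x) (fun x hx => hM0 x (sub (pos x hx))) (fun x hx => hM1 x (sub (pos x hx)))
  obtain ⟨i2, h2⟩ := norm_integral_oscillation_le (t := -t) (g := fun x => -g (-x))
    (g₁ := fun x => deriv g (-x)) (g₂ := fun x => -deriv (deriv g) (-x))
    (u := fun x => star (u (-x))) (u₁ := fun x => star (-deriv u (-x))) (M := M)
    hs (by rwa [abs_neg, abs_of_pos (by linarith)])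
    (fun x hx => by
      simpa [Function.comp_def] using
        HasDerivAt.fun_neg ((hgd (-x) (neg x hx)).1.comp x (hasDerivAt_neg x)))
    (fun x hx => by
      simpa [Function.comp_def] using (hgd (-x) (neg x hx)).2.comp x (hasDerivAt_neg x))
    (fun x hx => hg' _ (sub (neg x hx)))
    (fun x hx => by rw [abs_neg]; exact hg'' _ (sub (neg x hx)))
    (fun x _ => by
      simpa using ((hud (-x)).scomp x (hasDerivAt_neg x)).star)
    (fun x hx => by rw [norm_star]; exact hM0 _ (sub (neg x hx)))
    (fun x hx => by rw [norm_star, norm_neg]; exact hM1 _ (sub (neg x hx)))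
  set F : ℝ → ℂ := fun x =>
    u x * Complex.exp ((-(1 / 2) - Complex.I * (t : ℂ)) * (Real.log |x| : ℂ)) *
      Complex.exp (Complex.I * (s : ℂ) * (g x : ℂ)) with hF
  have e1 : (fun x => u x *
      (Complex.exp ((-(1 / 2) - Complex.I * (t : ℂ)) * (Real.log x : ℂ)) *
          Complex.exp (Complex.I * (s : ℂ) * (g x : ℂ)))) = F := by
    funext x
    simp only [hF, Real.log_abs, mul_assoc]
  have e2 : (fun x => star (u (-x)) *
      (Complex.exp ((-(1 / 2) - Complex.I * ((-t : ℝ) : ℂ)) * (Real.log x : ℂ)) *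
          Complex.exp (Complex.I * (s : ℂ) * ((-g (-x) : ℝ) : ℂ)))) =
      fun x => (starRingEnd ℂ) (F (-x)) := by
    funext x
    simp only [hF, map_mul, ← Complex.exp_conj, Real.log_abs, mul_assoc]
    simp [map_ofNat]
  rw [e1] at i1 h1
  rw [e2] at i2 h2
  have i3 : IntervalIntegrable F volume (-1) 0 := by
    rw [IntervalIntegrable.iff_comp_neg, neg_neg, neg_zero]
    refine IntervalIntegrable.symm ⟨?_, ?_⟩
    · simpa [IntegrableOn] using (Complex.conjCLE : ℂ →L[ℝ] ℂ).integrable_comp i2.1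
    · simp
  have h3 : ‖∫ x in (-1 : ℝ)..0, F x‖ ≤ 1205 * M * (√s)⁻¹ := by
    rwa [intervalIntegral.intervalIntegral_conj, RCLike.norm_conj, intervalIntegral.integral_comp_neg, neg_zero] at h2
  rw [Real.rpow_neg (by linarith), ← Real.sqrt_eq_rpow,
    ← intervalIntegral.integral_add_adjacent_intervals i3 i1]
  refine (norm_add_le _ _).trans ?_
  linarith
end

section
/- Let σ, σ' ∈ ℂ with Re(σ) > −1, Re(σ') > −1 and Re(σ) + Re(σ') = −1, and let α be the complex number with |α| = √π from the standard Beta-integral asymptotics. Then for every smooth compactly supported ψ : ℝ → ℂ there exist constants C₃, C₄ > 0 such that for every λ = i·t with real t ≥ 2(|σ| + |σ'|) + 1 and every a ∈ (0, 0.1], one has |∫_ℝ |x − a|^{σ + λ} · |x + a|^{σ' + λ} · ψ(x) dx − a^{σ + σ' + 1 + 2λ} · α · ψ(0) · |λ|^{−1/2}| ≤ C₃ · ‖ψ‖_{C¹} · |λ|^{−3/2} + C₄ · |ln a| · |λ|^{−2}. In particular the main term has modulus √π · |ψ(0)| · |λ|^{−1/2}, since Re(σ + σ' + 1 + 2λ)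 = 0. -/
open MeasureTheory Real

/-- `pw r z = r^z = exp(z · ln r)` for a real base `r > 0`. -/
noncomputable def pw (r : ℝ) (z : ℂ) : ℂ := Complex.exp (z * (Real.log r : ℂ))

/-- Global `C^N`-norm of `φ`. -/
noncomputable def Cnorm (N : ℕ) (φ : ℝ → ℂ) : ℝ :=
  ⨆ (m : Fin (N + 1)) (x : ℝ), ‖iteratedDeriv (m : ℕ) φ x‖

/-- If the angle between `u` and `v` is at most `π / 2`, then `u - v` is controlled by
`u ^ 2 - v ^ 2`. -/
lemma norm_sub_mul_norm_le_norm_sq_sub_sq {u v : ℂ} (h : 0 ≤ u.re * v.re + u.im * v.im) :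
    ‖u - v‖ * ‖v‖ ≤ ‖u ^ 2 - v ^ 2‖ := by
  have h1 : u ^ 2 - v ^ 2 = (u - v) * (u + v) := by ring
  rw [h1, norm_mul]
  gcongr
  rw [← sq_le_sq₀ (norm_nonneg _) (norm_nonneg _), Complex.sq_norm, Complex.sq_norm,
    Complex.normSq_apply, Complex.normSq_apply, Complex.add_re, Complex.add_im]
  nlinarith [sq_nonneg u.re, sq_nonneg u.im]

lemma cpow_half_sq (w : ℂ) : (w ^ (1 / 2 : ℂ)) ^ 2 = w := by
  rw [← Complex.cpow_nat_mul]; norm_num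

lemma re_mul_add_im_mul_cpow_half_nonneg {w w' : ℂ} (hw : 0 ≤ w.re) (hw' : 0 ≤ w'.re) :
    0 ≤ (w ^ (1 / 2 : ℂ)).re * (w' ^ (1 / 2 : ℂ)).re +
      (w ^ (1 / 2 : ℂ)).im * (w' ^ (1 / 2 : ℂ)).im := by
  have key : ∀ w : ℂ, 0 ≤ w.re → |(w ^ (1 / 2 : ℂ)).im| ≤ (w ^ (1 / 2 : ℂ)).re := by
    intro w hw
    have hre : 0 ≤ (w ^ (1 / 2 : ℂ)).re := by
      rw [one_div, Complex.cpow_inv_two_re]; positivity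
    have h2 := congrArg Complex.re (cpow_half_sq w)
    rw [pow_two, Complex.mul_re] at h2
    exact abs_le_of_sq_le_sq (by nlinarith) hre
  have h1 := key w hw
  have h2 := key w' hw'
  have h3 : |(w ^ (1 / 2 : ℂ)).im * (w' ^ (1 / 2 : ℂ)).im| ≤
      (w ^ (1 / 2 : ℂ)).re * (w' ^ (1 / 2 : ℂ)).re := by
    rw [abs_mul]
    exact mul_le_mul h1 h2 (abs_nonneg _) ((abs_nonneg _).trans h1)
  linarith [neg_abs_le ((w ^ (1 / 2 : ℂ)).im * (w' ^ (1 / 2 : ℂ)).im)]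

lemma norm_cpow_half_sub_mul_le {w w' : ℂ} (hw : 0 ≤ w.re) (hw' : 0 ≤ w'.re) :
    ‖w ^ (1 / 2 : ℂ) - w' ^ (1 / 2 : ℂ)‖ * ‖w' ^ (1 / 2 : ℂ)‖ ≤ ‖w - w'‖ := by
  simpa only [cpow_half_sq] using
    norm_sub_mul_norm_le_norm_sq_sub_sq (re_mul_add_im_mul_cpow_half_nonneg hw hw')

lemma norm_cpow_half_sq (w : ℂ) : ‖w ^ (1 / 2 : ℂ)‖ ^ 2 = ‖w‖ := by
  rw [← norm_pow, cpow_half_sq]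

/-- The normalised factors in the Gauss product for
`Γ(z + δ) Γ(z - δ) / (Γ(z) Γ(z + 1/2)) * z ^ (1 / 2)`. -/
noncomputable def gammaFactor (δ w : ℂ) : ℂ :=
  w * (w + 1 / 2) / ((w + δ) * (w - δ)) * (w ^ (1 / 2 : ℂ) / (w + 1) ^ (1 / 2 : ℂ))

lemma norm_gammaFactor_sub_one_le {δ w : ℂ} (hw : 0 < w.re) (hδ : 2 * ‖δ‖ ≤ ‖w‖) :
    ‖gammaFactor δ w - 1‖ ≤ (1 + 3 * ‖δ‖ ^ 2) / ‖w‖ ^ 2 := by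
  have hw0 : w ≠ 0 := by rintro rfl; simp at hw
  have hw1 : w + 1 ≠ 0 := by
    intro h; have := congrArg Complex.re h; simp at this; linarith
  set u := (w + 1) ^ (1 / 2 : ℂ) with hu
  set v := w ^ (1 / 2 : ℂ) with hv
  have hu2 : u ^ 2 = w + 1 := cpow_half_sq _
  have hv2 : v ^ 2 = w := cpow_half_sq _
  have hu0 : u ≠ 0 := by rintro h; rw [h] at hu2; simp at hu2; exact hw1 hu2.symm
  have hv0 : v ≠ 0 := by rintro h; rw [h] at hv2; simp at hv2; exact hw0 hv2.symm
  have hn : ‖w‖ ≤ ‖w + 1‖ := by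
    rw [← sq_le_sq₀ (norm_nonneg _) (norm_nonneg _), Complex.sq_norm, Complex.sq_norm,
      Complex.normSq_apply, Complex.normSq_apply]
    simp; nlinarith
  have hvn : ‖v‖ ^ 2 = ‖w‖ := norm_cpow_half_sq _
  have hun : ‖u‖ ^ 2 = ‖w + 1‖ := norm_cpow_half_sq _
  have hvpos : 0 < ‖v‖ := norm_pos_iff.2 hv0
  have hwpos : 0 < ‖w‖ := norm_pos_iff.2 hw0
  have huv : ‖v‖ ≤ ‖u‖ := by
    rw [← sq_le_sq₀ (norm_nonneg _) (norm_nonneg _), hvn, hun]; exact hn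
  have hd : ‖u - v‖ * ‖v‖ ≤ 1 := by
    have := norm_cpow_half_sub_mul_le (w := w + 1) (w' := w) (by simp; linarith) hw.le
    simpa only [hu, hv, add_sub_cancel_left, norm_one] using this
  have hden : 3 / 4 * ‖w‖ ^ 2 ≤ ‖(w + δ) * (w - δ)‖ := by
    have h1 : (w + δ) * (w - δ) = w ^ 2 - δ ^ 2 := by ring
    have h2 := norm_sub_norm_le (w ^ 2) (δ ^ 2)
    rw [h1]
    rw [norm_pow, norm_pow] at h2
    nlinarith [norm_nonneg δ]
  have hden0 : (w + δ) * (w - δ) ≠ 0 := by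
    rw [← norm_pos_iff]; nlinarith [pow_pos hwpos 2]
  have hid : gammaFactor δ w - 1 =
      (w ^ 2 * (u - v) ^ 2 / 2 + δ ^ 2 * (u * v)) / (((w + δ) * (w - δ)) * (u * v)) := by
    have e1 : gammaFactor δ w = w * (w + 1 / 2) / ((w + δ) * (w - δ)) * (v / u) := rfl
    have e2 : v / u = v ^ 2 / (u * v) := by field_simp
    rw [e1, e2, div_mul_div_comm, div_sub_one (mul_ne_zero hden0 (mul_ne_zero hu0 hv0))]
    congr 1
    have : (u - v) ^ 2 = 2 * w + 1 - 2 * (u * v) := by linear_combination hu2 + hv2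
    rw [this, hv2]; ring
  rw [hid, norm_div, norm_mul (_ * _) (u * v), norm_mul u v]
  have hD : 3 / 4 * ‖w‖ ^ 2 * (‖u‖ * ‖v‖) ≤ ‖(w + δ) * (w - δ)‖ * (‖u‖ * ‖v‖) := by gcongr
  have hN : ‖w ^ 2 * (u - v) ^ 2 / 2 + δ ^ 2 * (u * v)‖ ≤ ‖w‖ / 2 + ‖δ‖ ^ 2 * (‖u‖ * ‖v‖) := by
    refine (norm_add_le _ _).trans ?_
    have h1 : (‖u - v‖ * ‖v‖) ^ 2 ≤ 1 := pow_le_one₀ (by positivity) hd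
    rw [mul_pow, hvn] at h1
    simp only [norm_div, norm_mul, norm_pow, RCLike.norm_ofNat]
    nlinarith
  have hp : ‖w‖ ≤ ‖u‖ * ‖v‖ := by
    rw [← hvn, pow_two]; gcongr
  refine (div_le_div₀ (by positivity) hN (by positivity) hD).trans ?_
  rw [div_le_div_iff₀ (by positivity) (by positivity)]
  have h3 : ‖w‖ / 2 + ‖δ‖ ^ 2 * (‖u‖ * ‖v‖) ≤ (1 + 3 * ‖δ‖ ^ 2) * (3 / 4) * (‖u‖ * ‖v‖) := by
    nlinarith [mul_nonneg (sq_nonneg ‖δ‖) (hwpos.le.trans hp)]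
  calc _ ≤ (1 + 3 * ‖δ‖ ^ 2) * (3 / 4) * (‖u‖ * ‖v‖) * ‖w‖ ^ 2 := by gcongr
    _ = _ := by ring

lemma sum_one_div_sq_add_sq_le {τ : ℝ} (hτ : 3 / 4 ≤ τ) (n : ℕ) :
    ∑ j ∈ Finset.range n, 1 / ((j : ℝ) ^ 2 + τ ^ 2) ≤ 6 / τ := by
  have h : ∀ n : ℕ, ∑ j ∈ Finset.range n, 1 / ((j : ℝ) ^ 2 + τ ^ 2) ≤ 6 / τ - 6 / (n + τ) := by
    intro n
    induction n with
    | zero => simp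
    | succ n ih =>
      rw [Finset.sum_range_succ]
      have hn : (0 : ℝ) ≤ n := n.cast_nonneg
      have : 1 / ((n : ℝ) ^ 2 + τ ^ 2) ≤ 6 / (n + τ) - 6 / ((n + 1 : ℕ) + τ) := by
        push_cast
        rw [div_sub_div _ _ (by positivity) (by positivity),
          div_le_div_iff₀ (by positivity) (by positivity)]
        nlinarith [sq_nonneg ((n : ℝ) - τ), mul_nonneg hn (by linarith : 0 ≤ τ)]
      linarith
  have h2 : 0 ≤ 6 / ((n : ℝ) + τ) := by positivity
  linarith [h n]

open Filter Topology in
lemma tendsto_cpow_half_ratio (z : ℂ) (hz : 0 < z.re) :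
    Tendsto (fun n : ℕ => (z + n + 1) ^ (1 / 2 : ℂ) / (n : ℂ) ^ (1 / 2 : ℂ)) atTop (𝓝 1) := by
  have h1 : Tendsto (fun n : ℕ => ((z + 1) / n + 1) ^ (1 / 2 : ℂ)) atTop (𝓝 1) := by
    have h2 : Tendsto (fun n : ℕ => (z + 1) / n + 1) atTop (𝓝 (0 + 1)) :=
      (tendsto_const_div_atTop_nhds_zero_nat (z + 1)).add_const 1
    rw [zero_add] at h2
    simpa using h2.cpow (tendsto_const_nhds (x := (1 / 2 : ℂ))) (by simp)
  refine h1.congr' ?_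
  filter_upwards [eventually_gt_atTop 0] with n hn
  have hn' : (0 : ℝ) < n := by exact_mod_cast hn
  have hne : (n : ℂ) ≠ 0 := by exact_mod_cast hn.ne'
  have hw : (z + 1) / n + 1 ≠ 0 := by
    intro h
    have : z + 1 + n = 0 := by field_simp at h; simpa using h
    have := congrArg Complex.re this
    simp at this; linarith
  have e : z + n + 1 = ((n : ℝ) : ℂ) * ((z + 1) / n + 1) := by
    push_cast; field_simp; ring
  rw [e, Complex.cpow_def_of_ne_zero (mul_ne_zero (by exact_mod_cast hn.ne') hw),
    Complex.log_ofReal_mul hn' hw, Complex.cpow_def_of_ne_zero hw, Complex.cpow_def_of_ne_zero hne,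
    ← Complex.exp_sub, ← Complex.ofReal_natCast, ← Complex.ofReal_log hn'.le]
  congr 1; ring

lemma prod_gammaFactor (δ z : ℂ) (hz : 0 < z.re) (n : ℕ) :
    (∏ j ∈ Finset.range n, gammaFactor δ (z + j)) * (z + n) ^ (1 / 2 : ℂ) =
      z ^ (1 / 2 : ℂ) * ((∏ j ∈ Finset.range n, (z + j)) * (∏ j ∈ Finset.range n, (z + 1 / 2 + j)) /
        ((∏ j ∈ Finset.range n, (z + δ + j)) * (∏ j ∈ Finset.range n, (z - δ + j)))) := by
  have hne : ∀ j : ℕ, (z + j) ^ (1 / 2 : ℂ) ≠ 0 := by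
    intro j h
    have h2 := cpow_half_sq (z + j)
    rw [h] at h2
    have := congrArg Complex.re h2
    simp at this
    have hj : (0 : ℝ) ≤ j := j.cast_nonneg
    linarith
  induction n with
  | zero => simp
  | succ n ih =>
    have h1 := hne n
    have h2 := hne (n + 1)
    have h3 : ((n + 1 : ℕ) : ℂ) = (n : ℂ) + 1 := by push_cast; ring
    rw [h3, ← add_assoc] at h2 ⊢
    simp only [Finset.prod_range_succ]
    have e : gammaFactor δ (z + n) * (z + n + 1) ^ (1 / 2 : ℂ) =
      (z + n) ^ (1 / 2 : ℂ) * ((z + n) * (z + n + 1 / 2) / ((z + n + δ) * (z + n - δ))) := by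
      rw [gammaFactor]; field_simp
    rw [mul_assoc, e, ← mul_assoc, ih]
    rw [mul_assoc, div_mul_div_comm]
    congr 2 <;> ring

open Filter Topology in
lemma norm_gamma_ratio_sub_one_le {δ z : ℂ} (hz : z.re = 1 / 2) (hz' : 3 / 4 ≤ z.im)
    (hδ : 2 * ‖δ‖ ≤ z.im) (hδ' : |δ.re| < 1 / 2) :
    ‖z ^ (1 / 2 : ℂ) * (Complex.Gamma (z + δ) * Complex.Gamma (z - δ) /
      (Complex.Gamma z * Complex.Gamma (z + 1 / 2))) - 1‖ ≤
        Real.exp ((1 + 3 * ‖δ‖ ^ 2) * (6 / z.im)) - 1 := by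
  have hzpos : 0 < z.re := by rw [hz]; norm_num
  have hδ1 := abs_lt.1 hδ'
  have hprod : ∀ n : ℕ, ‖(∏ j ∈ Finset.range n, gammaFactor δ (z + j)) - 1‖ ≤
      Real.exp ((1 + 3 * ‖δ‖ ^ 2) * (6 / z.im)) - 1 := by
    intro n
    have h1 := Finset.norm_prod_one_add_sub_one_le (Finset.range n)
      (fun j => gammaFactor δ (z + j) - 1)
    simp only [add_sub_cancel] at h1
    refine h1.trans (sub_le_sub_right (Real.exp_le_exp.2 ?_) 1)
    calc ∑ j ∈ Finset.range n, ‖gammaFactor δ (z + j) - 1‖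
        ≤ ∑ j ∈ Finset.range n, (1 + 3 * ‖δ‖ ^ 2) * (1 / ((j : ℝ) ^ 2 + z.im ^ 2)) := by
          refine Finset.sum_le_sum fun j _ => ?_
          have hj : (0 : ℝ) ≤ j := j.cast_nonneg
          have him : z.im ≤ ‖z + j‖ := by
            have := Complex.im_le_norm (z + j); simpa using this
          refine (norm_gammaFactor_sub_one_le (by simp; linarith) (hδ.trans him)).trans ?_
          rw [div_eq_mul_one_div]
          gcongr
          rw [Complex.sq_norm, Complex.normSq_apply]
          simp only [Complex.add_re, Complex.natCast_re, Complex.add_im, Complex.natCast_im,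
            add_zero, hz]
          nlinarith
      _ ≤ _ := by
          rw [← Finset.mul_sum]
          gcongr
          exact sum_one_div_sq_add_sq_le hz' n
  have hΓ : ∀ w : ℂ, 0 < w.re → Complex.Gamma w ≠ 0 := fun w hw =>
    Complex.Gamma_ne_zero_of_re_pos hw
  have hlim := ((Complex.GammaSeq_tendsto_Gamma (z + δ)).mul
    (Complex.GammaSeq_tendsto_Gamma (z - δ))).div
    ((Complex.GammaSeq_tendsto_Gamma z).mul (Complex.GammaSeq_tendsto_Gamma (z + 1 / 2)))
    (mul_ne_zero (hΓ _ hzpos) (hΓ _ (by simp; linarith)))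
  have hlim2 := ((hlim.const_mul (z ^ (1 / 2 : ℂ))).div
    (tendsto_cpow_half_ratio z hzpos) one_ne_zero)
  rw [div_one] at hlim2
  refine le_of_tendsto (hlim2.sub_const 1).norm ?_
  filter_upwards [eventually_gt_atTop 0] with n hn
  refine le_of_eq_of_le ?_ (hprod (n + 1))
  congr 2
  have hne : (n : ℂ) ≠ 0 := by exact_mod_cast hn.ne'
  have key := prod_gammaFactor δ z hzpos (n + 1)
  have hs : (z + n + 1) ^ (1 / 2 : ℂ) ≠ 0 := by
    intro h
    have h2 := cpow_half_sq (z + n + 1)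
    rw [h] at h2
    have := congrArg Complex.re h2
    simp at this
    have hj : (0 : ℝ) ≤ n := n.cast_nonneg
    linarith
  have h3 : ((n + 1 : ℕ) : ℂ) = (n : ℂ) + 1 := by push_cast; ring
  rw [h3, ← add_assoc] at key
  have hpow : (n : ℂ) ^ (z + δ) * (n : ℂ) ^ (z - δ) * (n : ℂ) ^ (1 / 2 : ℂ) =
      (n : ℂ) ^ z * (n : ℂ) ^ (z + 1 / 2) := by
    rw [← Complex.cpow_add _ _ hne, ← Complex.cpow_add _ _ hne, ← Complex.cpow_add _ _ hne]
    congr 1; ring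
  have hfac : (n.factorial : ℂ) ≠ 0 := by exact_mod_cast n.factorial_ne_zero
  have hp : ∀ w : ℂ, 0 < w.re → ∏ j ∈ Finset.range (n + 1), (w + j) ≠ 0 := by
    intro w hw
    refine Finset.prod_ne_zero_iff.2 fun j _ h => ?_
    have := congrArg Complex.re h
    simp at this
    have hj : (0 : ℝ) ≤ j := j.cast_nonneg
    linarith
  have hc : ∀ w : ℂ, (n : ℂ) ^ w ≠ 0 := fun w h => hne ((Complex.cpow_eq_zero_iff _ _).1 h).1
  rw [eq_comm, ← mul_left_inj' hs, key]
  simp only [Complex.GammaSeq, Pi.div_apply]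
  have p1 := hp z hzpos
  have p2 := hp (z + 1 / 2) (by simp; linarith)
  have p3 := hp (z + δ) (by simp; linarith)
  have p4 := hp (z - δ) (by simp; linarith)
  have c1 := hc z
  have c2 := hc (z + 1 / 2)
  have c3 := hc (1 / 2)
  generalize ∏ j ∈ Finset.range (n + 1), (z + (j : ℂ)) = P1 at *
  generalize ∏ j ∈ Finset.range (n + 1), (z + 1 / 2 + (j : ℂ)) = P2 at *
  generalize ∏ j ∈ Finset.range (n + 1), (z + δ + (j : ℂ)) = P3 at *
  generalize ∏ j ∈ Finset.range (n + 1), (z - δ + (j : ℂ)) = P4 at *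
  generalize (n : ℂ) ^ z = N1 at *
  generalize (n : ℂ) ^ (z + 1 / 2) = N2 at *
  generalize (n : ℂ) ^ (z + δ) = N3 at *
  generalize (n : ℂ) ^ (z - δ) = N4 at *
  generalize (n : ℂ) ^ (1 / 2 : ℂ) = N5 at *
  generalize (z + n + 1) ^ (1 / 2 : ℂ) = U at *
  generalize z ^ (1 / 2 : ℂ) = V at *
  field_simp
  linear_combination (-V) * hpow

lemma exp_sub_one_le_mul_exp (x : ℝ) : Real.exp x - 1 ≤ x * Real.exp x := by
  have h := Real.add_one_le_exp (-x)
  have h2 : Real.exp (-x) * Real.exp x = 1 := by rw [← Real.exp_add]; simp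
  nlinarith [Real.exp_pos x]

lemma cpow_half_I_mul {t : ℝ} (ht : 0 < t) :
    (Complex.I * (t : ℂ)) ^ (1 / 2 : ℂ) = Complex.exp (π / 4 * Complex.I) * (Real.sqrt t : ℂ) := by
  rw [mul_comm, Complex.cpow_def_of_ne_zero (by simp [ht.ne']),
    Complex.log_ofReal_mul ht Complex.I_ne_zero, Complex.log_I, Real.sqrt_eq_rpow,
    Complex.ofReal_cpow ht.le, Complex.cpow_def_of_ne_zero (by simp [ht.ne']), ← Complex.exp_add,
    Complex.ofReal_log ht.le]
  congr 1; push_cast; ring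

lemma gamma_ratio_asymptotics (σ σ' : ℂ) (hσ : -1 < σ.re) (hσ' : -1 < σ'.re)
    (hsum : σ.re + σ'.re = -1) :
    ∃ C : ℝ, 0 ≤ C ∧ ∀ t : ℝ, 2 * (‖σ‖ + ‖σ'‖) + 1 ≤ t →
      ‖Complex.Gamma (σ + Complex.I * t + 1) * Complex.Gamma (σ' + Complex.I * t + 1) /
        (Complex.Gamma ((σ + Complex.I * t + (σ' + Complex.I * t) + 2) / 2) *
          Complex.Gamma ((σ + Complex.I * t + (σ' + Complex.I * t) + 2) / 2 + 1 / 2)) -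
        Complex.exp (-(π / 4 * Complex.I)) * ((Real.sqrt t)⁻¹ : ℝ)‖ ≤ C / (t * Real.sqrt t) := by
  set δ : ℂ := (σ - σ') / 2 with hδ
  set D : ℝ := 1 + 3 * ‖δ‖ ^ 2 with hD
  have hD0 : 0 ≤ D := by positivity
  refine ⟨2 * (8 * D * Real.exp (8 * D)) + 2 * ‖(σ + σ' + 2) / 2‖, by positivity, fun t ht => ?_⟩
  have ht1 : 1 ≤ t := by linarith [norm_nonneg σ, norm_nonneg σ']
  have ht0 : 0 < t := by linarith
  set z : ℂ := (σ + Complex.I * t + (σ' + Complex.I * t) + 2) / 2 with hz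
  have e1 : σ + Complex.I * t + 1 = z + δ := by rw [hz, hδ]; ring
  have e2 : σ' + Complex.I * t + 1 = z - δ := by rw [hz, hδ]; ring
  have zre : z.re = 1 / 2 := by
    rw [hz]; simp; linarith
  have zim : z.im = t + (σ.im + σ'.im) / 2 := by
    rw [hz]; simp; ring
  have i1 := (abs_le.1 (Complex.abs_im_le_norm σ)).1
  have i2 := (abs_le.1 (Complex.abs_im_le_norm σ')).1
  have zim' : 3 / 4 * t ≤ z.im := by rw [zim]; linarith
  have δn : ‖δ‖ ≤ (‖σ‖ + ‖σ'‖) / 2 := by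
    rw [hδ, norm_div]; simpa using div_le_div_of_nonneg_right (norm_sub_le σ σ') zero_le_two
  have hδre : |δ.re| < 1 / 2 := by
    have : δ.re = (σ.re - σ'.re) / 2 := by rw [hδ]; simp
    rw [this, abs_lt]; constructor <;> linarith
  have key := norm_gamma_ratio_sub_one_le (δ := δ) (z := z) zre (by linarith) (by linarith) hδre
  rw [e1, e2]
  set Q := Complex.Gamma (z + δ) * Complex.Gamma (z - δ) /
    (Complex.Gamma z * Complex.Gamma (z + 1 / 2)) with hQ
  set r := Real.sqrt t with hr
  have hr0 : 0 < r := Real.sqrt_pos.2 ht0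
  have hrt : r ^ 2 = t := Real.sq_sqrt ht0.le
  set u := z ^ (1 / 2 : ℂ) with hu
  set v := (Complex.I * (t : ℂ)) ^ (1 / 2 : ℂ) with hv
  have hvr : v = Complex.exp (π / 4 * Complex.I) * (r : ℂ) := cpow_half_I_mul ht0
  have hvn : ‖v‖ = r := by
    rw [hvr, norm_mul, Complex.norm_real, Real.norm_of_nonneg hr0.le]
    have : (π / 4 * Complex.I : ℂ) = ((π / 4 : ℝ) : ℂ) * Complex.I := by push_cast; ring
    rw [this, Complex.norm_exp_ofReal_mul_I, one_mul]
  have hvi : Complex.exp (-(π / 4 * Complex.I)) * ((r⁻¹ : ℝ) : ℂ) = v⁻¹ := by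
    rw [hvr, mul_inv, Complex.exp_neg]; push_cast; rfl
  have hun2 : ‖u‖ ^ 2 = ‖z‖ := norm_cpow_half_sq z
  have hun : r / 2 ≤ ‖u‖ := by
    rw [← sq_le_sq₀ (by positivity) (norm_nonneg _), hun2, div_pow, hrt]
    linarith [Complex.im_le_norm z]
  have hu0 : u ≠ 0 := by rw [← norm_pos_iff]; linarith
  have hv0 : v ≠ 0 := by rw [← norm_pos_iff, hvn]; exact hr0
  have huv : ‖u - v‖ * r ≤ ‖(σ + σ' + 2) / 2‖ := by
    have := norm_cpow_half_sub_mul_le (w := z) (w' := Complex.I * t) (by rw [zre]; norm_num)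
      (by simp)
    rw [← hu, ← hv, hvn] at this
    convert this using 2
    rw [hz]; ring
  rw [hvi]
  have hdec : Q - v⁻¹ = u⁻¹ * (u * Q - 1) - u⁻¹ * v⁻¹ * (u - v) := by
    field_simp; ring
  have hui : ‖u⁻¹‖ ≤ 2 / r := by
    rw [norm_inv, ← inv_div]; exact inv_anti₀ (by positivity) hun
  have hexp : Real.exp (D * (6 / z.im)) - 1 ≤ 8 * D * Real.exp (8 * D) / t := by
    have h6 : 6 / z.im ≤ 8 / t := by
      rw [div_le_div_iff₀ (by linarith) ht0]; linarith
    have h8 : 8 / t ≤ 8 := div_le_self (by norm_num) ht1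
    have h60 : 0 ≤ 6 / z.im := div_nonneg (by norm_num) (by linarith)
    calc _ ≤ D * (6 / z.im) * Real.exp (D * (6 / z.im)) := exp_sub_one_le_mul_exp _
      _ ≤ D * (8 / t) * Real.exp (8 * D) := by
        have : D * (6 / z.im) ≤ 8 * D := by nlinarith [h6.trans h8]
        gcongr
      _ = _ := by ring
  calc ‖Q - v⁻¹‖ ≤ ‖u⁻¹‖ * ‖u * Q - 1‖ + ‖u⁻¹‖ * ‖v⁻¹‖ * ‖u - v‖ := by
        rw [hdec, ← norm_mul, ← norm_mul, ← norm_mul]; exact norm_sub_le _ _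
    _ ≤ 2 / r * (8 * D * Real.exp (8 * D) / t) +
        2 / r * r⁻¹ * (‖(σ + σ' + 2) / 2‖ / r) := by
        gcongr
        · exact key.trans hexp
        · rw [norm_inv, hvn]
        · rwa [le_div_iff₀ hr0]
    _ = _ := by
        rw [← hrt]; field_simp

/-- The weight `|x - a| ^ μ * |x + a| ^ ν`. -/
noncomputable def weight (a : ℝ) (μ ν : ℂ) (x : ℝ) : ℂ := pw |x - a| μ * pw |x + a| ν

lemma pw_eq_cpow {r : ℝ} (hr : 0 < r) (z : ℂ) : pw r z = (r : ℂ) ^ z := by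
  rw [pw, Complex.cpow_def_of_ne_zero (by exact_mod_cast hr.ne'), Complex.ofReal_log hr.le,
    mul_comm]

lemma integral_weight {a : ℝ} (ha : 0 < a) {μ ν : ℂ} (hμ : -1 < μ.re) (hν : -1 < ν.re) :
    ∫ x in (-a)..a, weight a μ ν x = pw a (μ + ν + 1) * (Real.sqrt π : ℂ) *
      (Complex.Gamma (μ + 1) * Complex.Gamma (ν + 1) /
        (Complex.Gamma ((μ + ν + 2) / 2) * Complex.Gamma ((μ + ν + 2) / 2 + 1 / 2))) := by
  have h1 : ∫ x in (-a)..a, weight a μ ν x =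
      ∫ x in (-a)..a, (fun u : ℝ => (u : ℂ) ^ (ν + 1 - 1) * (((2 * a : ℝ) : ℂ) - u) ^ (μ + 1 - 1))
        (x + a) := by
    refine intervalIntegral.integral_congr_ae ?_
    have : ∀ᵐ x : ℝ, x ≠ a := by simp [ae_iff]
    filter_upwards [this] with x hx hx'
    rw [Set.uIoc_of_le (by linarith)] at hx'
    have hxa : x < a := lt_of_le_of_ne hx'.2 hx
    have e : ((2 * a : ℝ) : ℂ) - ((x + a : ℝ) : ℂ) = ((a - x : ℝ) : ℂ) := by push_cast; ring
    simp only [add_sub_cancel_right]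
    rw [e, weight, abs_sub_comm, abs_of_pos (by linarith : 0 < a - x),
      abs_of_pos (by linarith [hx'.1] : 0 < x + a), pw_eq_cpow (by linarith),
      pw_eq_cpow (by linarith [hx'.1]), mul_comm]
  have hΓ : Complex.Gamma (μ + ν + 2) ≠ 0 := Complex.Gamma_ne_zero_of_re_pos (by simp; linarith)
  have hB := Complex.Gamma_mul_Gamma_eq_betaIntegral (s := ν + 1) (t := μ + 1)
    (by simp; linarith) (by simp; linarith)
  have hd := Complex.Gamma_mul_Gamma_add_half ((μ + ν + 2) / 2)
  have ha2 : (0 : ℝ) ≤ 2 := by norm_num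
  have e1 : (((2 * a : ℝ)) : ℂ) ^ (ν + 1 + (μ + 1) - 1) = (2 : ℂ) ^ (μ + ν + 1) * pw a (μ + ν + 1) := by
    rw [pw_eq_cpow ha, Complex.ofReal_mul, Complex.mul_cpow_ofReal_nonneg ha2 ha.le]
    have : ν + 1 + (μ + 1) - 1 = μ + ν + 1 := by ring
    rw [this]; norm_num
  have e2 : (2 : ℂ) ^ (1 - 2 * ((μ + ν + 2) / 2)) = ((2 : ℂ) ^ (μ + ν + 1))⁻¹ := by
    rw [← Complex.cpow_neg]; congr 1; ring
  have e3 : 2 * ((μ + ν + 2) / 2) = μ + ν + 2 := by ring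
  have e4 : ν + 1 + (μ + 1) = μ + ν + 2 := by ring
  have h2 : (2 : ℂ) ^ (μ + ν + 1) ≠ 0 := fun h => two_ne_zero ((Complex.cpow_eq_zero_iff _ _).1 h).1
  have hpi : (Real.sqrt π : ℂ) ≠ 0 := by
    simpa using (Real.sqrt_pos.2 Real.pi_pos).ne'
  rw [h1, intervalIntegral.integral_comp_add_right
    (fun u : ℝ => (u : ℂ) ^ (ν + 1 - 1) * (((2 * a : ℝ) : ℂ) - u) ^ (μ + 1 - 1)) a, neg_add_cancel, ← two_mul,
    Complex.betaIntegral_scaled _ _ (by linarith), e1, hd, e2, e3]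
  rw [e4] at hB
  rw [mul_comm (Complex.Gamma (μ + 1)), hB]
  field_simp

lemma weight_eq_exp (a : ℝ) (μ ν : ℂ) (x : ℝ) : weight a μ ν x =
    Complex.exp (μ * (Real.log (x - a) : ℂ)) * Complex.exp (ν * (Real.log (x + a) : ℂ)) := by
  simp only [weight, pw, Real.log_abs]

lemma weight_neg (a : ℝ) (μ ν : ℂ) (x : ℝ) : weight a μ ν (-x) = weight a ν μ x := by
  rw [weight, weight, mul_comm, ← abs_neg (-x + a), ← abs_neg (-x - a)]
  congr 3 <;> ring

lemma measurable_weight (a : ℝ) (μ ν : ℂ) : Measurable (weight a μ ν) := by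
  have : weight a μ ν = fun x => Complex.exp (μ * (Real.log (x - a) : ℂ)) *
      Complex.exp (ν * (Real.log (x + a) : ℂ)) := funext (weight_eq_exp a μ ν)
  rw [this]
  fun_prop

lemma norm_weight {a x : ℝ} (μ ν : ℂ) (h1 : x ≠ a) (h2 : x ≠ -a) :
    ‖weight a μ ν x‖ = |x - a| ^ μ.re * |x + a| ^ ν.re := by
  have h3 : 0 < |x - a| := abs_pos.2 (sub_ne_zero.2 h1)
  have h4 : 0 < |x + a| := abs_pos.2 (fun h => h2 (by linarith))
  rw [weight, norm_mul, pw, pw, Complex.norm_exp, Complex.norm_exp, Real.rpow_def_of_pos h3,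
    Real.rpow_def_of_pos h4, Complex.re_mul_ofReal, Complex.re_mul_ofReal, mul_comm (Real.log _),
    mul_comm (Real.log _)]

/-- The function `(a ^ 2 - x ^ 2) * weight a μ ν x`, whose derivative is the weight times an
affine function. -/
noncomputable def weightPrimitive (a : ℝ) (μ ν : ℂ) (x : ℝ) : ℂ :=
  ((a ^ 2 - x ^ 2 : ℝ) : ℂ) * weight a μ ν x

lemma hasDerivAt_weightPrimitive {a x : ℝ} (μ ν : ℂ) (h1 : x ≠ a) (h2 : x ≠ -a) :
    HasDerivAt (weightPrimitive a μ ν)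
      (-(((μ + ν + 2) * x + a * (μ - ν)) * weight a μ ν x)) x := by
  have h3 : x - a ≠ 0 := sub_ne_zero.2 h1
  have h4 : x + a ≠ 0 := fun h => h2 (by linarith)
  have d1 : HasDerivAt (fun x : ℝ => ((Real.log (x - a) : ℝ) : ℂ)) (((x - a)⁻¹ : ℝ) : ℂ) x := by
    have := ((hasDerivAt_id x).sub_const a).log h3
    simpa using this.ofReal_comp
  have d2 : HasDerivAt (fun x : ℝ => ((Real.log (x + a) : ℝ) : ℂ)) (((x + a)⁻¹ : ℝ) : ℂ) x := by
    have := ((hasDerivAt_id x).add_const a).log h4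
    simpa using this.ofReal_comp
  have d3 : HasDerivAt (fun x : ℝ => ((a ^ 2 - x ^ 2 : ℝ) : ℂ)) ((-(2 * x) : ℝ) : ℂ) x := by
    have := ((hasDerivAt_pow 2 x).const_sub (a ^ 2)).ofReal_comp
    simpa using this
  have d := d3.mul ((d1.const_mul μ).cexp.mul (d2.const_mul ν).cexp)
  have e : weightPrimitive a μ ν = (fun x : ℝ => ((a ^ 2 - x ^ 2 : ℝ) : ℂ)) *
      ((fun x => Complex.exp (μ * (Real.log (x - a) : ℂ))) *
        (fun x => Complex.exp (ν * (Real.log (x + a) : ℂ)))) := by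
    ext y; simp only [weightPrimitive, weight_eq_exp, Pi.mul_apply]
  rw [e]
  refine d.congr_deriv ?_
  rw [weight_eq_exp]
  simp only [Pi.mul_apply]
  have h3' : (x : ℂ) - a ≠ 0 := by exact_mod_cast h3
  have h4' : (x : ℂ) + a ≠ 0 := by exact_mod_cast h4
  push_cast
  field_simp
  ring

lemma norm_weightPrimitive (a : ℝ) {μ ν : ℂ} (hμ : -1 < μ.re) (hν : -1 < ν.re) (x : ℝ) :
    ‖weightPrimitive a μ ν x‖ = |x - a| ^ (μ.re + 1) * |x + a| ^ (ν.re + 1) := by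
  by_cases h1 : x = a
  · subst h1
    rw [weightPrimitive, sub_self, sub_self, abs_zero, Real.zero_rpow (by linarith)]; simp
  by_cases h2 : x = -a
  · subst h2
    rw [weightPrimitive, neg_add_cancel, abs_zero, Real.zero_rpow (x := ν.re + 1) (by linarith)]
    simp
  have h3 : 0 < |x - a| := abs_pos.2 (sub_ne_zero.2 h1)
  have h4 : 0 < |x + a| := abs_pos.2 (fun h => h2 (by linarith))
  have e : a ^ 2 - x ^ 2 = -((x - a) * (x + a)) := by ring
  rw [weightPrimitive, norm_mul, norm_weight μ ν h1 h2, Complex.norm_real, Real.norm_eq_abs, e,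
    abs_neg, abs_mul, Real.rpow_add_one h3.ne', Real.rpow_add_one h4.ne']
  ring

lemma continuous_weightPrimitive (a : ℝ) {μ ν : ℂ} (hμ : -1 < μ.re) (hν : -1 < ν.re) :
    Continuous (weightPrimitive a μ ν) := by
  have hc : Continuous fun x : ℝ => |x - a| ^ (μ.re + 1) * |x + a| ^ (ν.re + 1) := by
    refine Continuous.mul ?_ ?_ <;>
    exact Continuous.rpow_const (by fun_prop) (fun _ => Or.inr (by linarith))
  rw [continuous_iff_continuousAt]
  intro x
  by_cases h : x = a ∨ x = -a
  · have h0 : |x - a| ^ (μ.re + 1) * |x + a| ^ (ν.re + 1) = 0 := by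
      rcases h with rfl | rfl
      · rw [sub_self, abs_zero, Real.zero_rpow (by linarith), zero_mul]
      · rw [neg_add_cancel, abs_zero, Real.zero_rpow (x := ν.re + 1) (by linarith), mul_zero]
    have h1 : weightPrimitive a μ ν x = 0 := by
      rw [← norm_eq_zero, norm_weightPrimitive a hμ hν, h0]
    rw [ContinuousAt, h1, tendsto_zero_iff_norm_tendsto_zero]
    have := hc.tendsto x
    rw [h0] at this
    exact this.congr fun y => (norm_weightPrimitive a hμ hν y).symm
  · push Not at h
    exact (hasDerivAt_weightPrimitive μ ν h.1 h.2).continuousAt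

/-- Integration by parts against the weight. -/
lemma integral_weight_mul_self_mul {a p q : ℝ} {μ ν : ℂ} (hμ : -1 < μ.re) (hν : -1 < ν.re)
    (hpq : p ≤ q) (hint : IntervalIntegrable (weight a μ ν) volume p q)
    (ha : ∀ x ∈ Set.Ioo p q, x ≠ a ∧ x ≠ -a) {K K' : ℝ → ℂ}
    (hK : ∀ x ∈ Set.Icc p q, HasDerivAt K (K' x) x) (hK' : ContinuousOn K' (Set.Icc p q))
    (hp : weightPrimitive a μ ν p * K p = 0) (hq : weightPrimitive a μ ν q * K q = 0) :
    (μ + ν + 2) * ∫ x in p..q, weight a μ ν x * (x * K x) =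
      ∫ x in p..q, weight a μ ν x * ((a ^ 2 - x ^ 2) * K' x - a * (μ - ν) * K x) := by
  have hKc : ContinuousOn K (Set.Icc p q) := fun x hx => (hK x hx).continuousAt.continuousWithinAt
  have hi : ∀ f : ℝ → ℂ, ContinuousOn f (Set.Icc p q) →
      IntervalIntegrable (fun x => weight a μ ν x * f x) volume p q := fun f hf =>
    hint.mul_continuousOn (by rwa [Set.uIcc_of_le hpq])
  have i1 := hi (fun x => x * K x) (by fun_prop)
  have i2 := hi (fun x => (a ^ 2 - x ^ 2) * K' x - a * (μ - ν) * K x) (by fun_prop)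
  have hftc := intervalIntegral.integral_eq_sub_of_hasDerivAt_of_le hpq
    (f := fun x => weightPrimitive a μ ν x * K x)
    (f' := fun x => weight a μ ν x * ((a ^ 2 - x ^ 2) * K' x - a * (μ - ν) * K x) -
      (μ + ν + 2) * (weight a μ ν x * (x * K x)))
    ((continuous_weightPrimitive a hμ hν).continuousOn.mul hKc) ?_
    (i2.sub (i1.const_mul _))
  · rw [intervalIntegral.integral_sub i2 (i1.const_mul _),
      intervalIntegral.integral_const_mul, hp, hq, sub_zero] at hftc
    exact (sub_eq_zero.1 hftc).symm
  · intro x hx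
    have h := (hasDerivAt_weightPrimitive μ ν (ha x hx).1 (ha x hx).2).mul
      (hK x (Set.Ioo_subset_Icc_self hx))
    refine h.congr_deriv ?_
    simp only [weightPrimitive]; push_cast; ring

/-- A measurable function on `[p, q]` dominated by the derivative of a continuous function `G` is
integrable, with the integral of its norm bounded by `G q - G p`. -/
lemma intervalIntegrable_of_norm_le_deriv {f : ℝ → ℂ} {G g : ℝ → ℝ} {p q : ℝ} (hpq : p ≤ q)
    (hf : Measurable f) (hG : ContinuousOn G (Set.Icc p q))
    (hg : ∀ x ∈ Set.Ioo p q, HasDerivAt G (g x) x) (hfg : ∀ x ∈ Set.Ioo p q, ‖f x‖ ≤ g x) :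
    IntervalIntegrable f volume p q ∧ ∫ x in p..q, ‖f x‖ ≤ G q - G p := by
  have hgi : IntegrableOn g (Set.Ioc p q) :=
    intervalIntegral.integrableOn_deriv_of_nonneg hG hg fun x hx =>
      (norm_nonneg _).trans (hfg x hx)
  have hgi' : IntervalIntegrable g volume p q := (intervalIntegrable_iff_integrableOn_Ioc_of_le hpq).2 hgi
  have hae : ∀ᵐ x ∂(volume.restrict (Set.Ioc p q)), ‖f x‖ ≤ g x := by
    rw [← Measure.restrict_congr_set Ioo_ae_eq_Ioc]
    exact (ae_restrict_iff' measurableSet_Ioo).2 (Filter.Eventually.of_forall hfg)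
  have hfi : IntervalIntegrable f volume p q :=
    (intervalIntegrable_iff_integrableOn_Ioc_of_le hpq).2
      (hgi.mono' hf.aestronglyMeasurable hae)
  refine ⟨hfi, ?_⟩
  rw [← intervalIntegral.integral_eq_sub_of_hasDerivAt_of_le hpq hG hg hgi',
    intervalIntegral.integral_of_le hpq, intervalIntegral.integral_of_le hpq]
  exact integral_mono_ae ((intervalIntegrable_iff_integrableOn_Ioc_of_le hpq).1 hfi.norm) hgi hae

lemma weight_inner {a : ℝ} (ha : 0 < a) {μ ν : ℂ} (hμ : -1 < μ.re) (hν : -1 < ν.re)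
    (hsum : μ.re + ν.re = -1) :
    IntervalIntegrable (weight a μ ν) volume (-a) a ∧
      ∫ x in (-a)..a, ‖weight a μ ν x‖ ≤ 2 / (μ.re + 1) + 2 / (ν.re + 1) := by
  set s := μ.re with hs
  set s' := ν.re with hs'
  have hs1 : 0 < s + 1 := by linarith
  have hs1' : 0 < s' + 1 := by linarith
  have main := intervalIntegrable_of_norm_le_deriv (f := weight a μ ν)
    (G := fun x => a ^ s * ((a + x) ^ (s' + 1) / (s' + 1)) -
      a ^ s' * ((a - x) ^ (s + 1) / (s + 1)))
    (g := fun x => a ^ s * (a + x) ^ s' + a ^ s' * (a - x) ^ s) (p := -a) (q := a) (by linarith)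
    (measurable_weight a μ ν)
  specialize main ?_ ?_ ?_; rotate_right
  · refine ⟨main.1, main.2.trans ?_⟩
    have e1 : a ^ s * (a + a) ^ (s' + 1) = 2 ^ (s' + 1) := by
      rw [← two_mul, Real.mul_rpow zero_le_two ha.le, mul_left_comm, ← Real.rpow_add ha]
      rw [show s + (s' + 1) = 0 by linarith, Real.rpow_zero, mul_one]
    have e2 : a ^ s' * (a + a) ^ (s + 1) = 2 ^ (s + 1) := by
      rw [← two_mul, Real.mul_rpow zero_le_two ha.le, mul_left_comm, ← Real.rpow_add ha]
      rw [show s' + (s + 1) = 0 by linarith, Real.rpow_zero, mul_one]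
    have e3 : (2 : ℝ) ^ (s' + 1) ≤ 2 := by
      simpa using Real.rpow_le_rpow_of_exponent_le one_le_two (by linarith : s' + 1 ≤ 1)
    have e4 : (2 : ℝ) ^ (s + 1) ≤ 2 := by
      simpa using Real.rpow_le_rpow_of_exponent_le one_le_two (by linarith : s + 1 ≤ 1)
    simp only [sub_self, sub_neg_eq_add, add_neg_cancel, Real.zero_rpow hs1.ne',
      Real.zero_rpow hs1'.ne', zero_div, mul_zero, sub_zero, zero_sub, ← mul_div_assoc, e1, e2]
    rw [add_comm]
    gcongr
  · refine ContinuousOn.sub ?_ ?_ <;>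
    · refine continuousOn_const.mul (ContinuousOn.div_const ?_ _)
      exact ContinuousOn.rpow_const (by fun_prop) fun _ _ => Or.inr (by linarith)
  · intro x hx
    have hx1 : 0 < a + x := by linarith [hx.1]
    have hx2 : 0 < a - x := by linarith [hx.2]
    have d1 := ((((hasDerivAt_id x).const_add a).rpow_const (p := s' + 1)
      (Or.inl hx1.ne')).div_const (s' + 1)).const_mul (a ^ s)
    have d2 := ((((hasDerivAt_id x).const_sub a).rpow_const (p := s + 1)
      (Or.inl hx2.ne')).div_const (s + 1)).const_mul (a ^ s')
    refine (d1.sub d2).congr_deriv ?_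
    simp only [id, add_sub_cancel_right]
    field_simp
    ring
  · intro x hx
    have hx1 : 0 < a + x := by linarith [hx.1]
    have hx2 : 0 < a - x := by linarith [hx.2]
    rw [norm_weight μ ν hx.2.ne hx.1.ne', abs_sub_comm, add_comm x a, abs_of_pos hx1,
      abs_of_pos hx2, ← hs, ← hs']
    rcases le_total 0 x with h | h
    · have : (a + x) ^ s' ≤ a ^ s' :=
        Real.rpow_le_rpow_of_nonpos ha (by linarith) (by linarith)
      have h3 : 0 ≤ a ^ s * (a + x) ^ s' := by positivity
      have h4 : (a - x) ^ s * (a + x) ^ s' ≤ (a - x) ^ s * a ^ s' := by gcongr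
      linarith
    · have : (a - x) ^ s ≤ a ^ s :=
        Real.rpow_le_rpow_of_nonpos ha (by linarith) (by linarith)
      have h3 : 0 ≤ a ^ s' * (a - x) ^ s := by positivity
      have h4 : (a - x) ^ s * (a + x) ^ s' ≤ a ^ s * (a + x) ^ s' := by gcongr
      linarith

lemma weight_outer {a R : ℝ} (ha : 0 < a) (haR : a ≤ R) {μ ν : ℂ} (hμ : -1 < μ.re)
    (hsum : μ.re + ν.re = -1) :
    IntervalIntegrable (weight a μ ν) volume a R ∧
      ∫ x in a..R, ‖weight a μ ν x‖ ≤ Real.log (R / a) + 1 / (μ.re + 1) := by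
  set s := μ.re with hs
  set s' := ν.re with hs'
  have hs1 : 0 < s + 1 := by linarith
  have hq : ∀ x, a ≤ x → 0 < x + a := fun x hx => by linarith
  have main := intervalIntegrable_of_norm_le_deriv (f := weight a μ ν)
    (G := fun x => Real.log (x + a) + ((x - a) / (x + a)) ^ (s + 1) / (s + 1))
    (g := fun x => 1 / (x + a) + ((x - a) / (x + a)) ^ s * (2 * a / (x + a) ^ 2)) (p := a) (q := R)
    haR (measurable_weight a μ ν)
  specialize main ?_ ?_ ?_; rotate_right
  · refine ⟨main.1, main.2.trans ?_⟩
    have hR : 0 < R := by linarith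
    have e1 : ((R - a) / (R + a)) ^ (s + 1) ≤ 1 :=
      Real.rpow_le_one (div_nonneg (by linarith) (by linarith))
        ((div_le_one (by linarith)).2 (by linarith)) hs1.le
    have e2 : ((R - a) / (R + a)) ^ (s + 1) / (s + 1) ≤ 1 / (s + 1) := by gcongr
    have e3 : Real.log (R + a) - Real.log (a + a) ≤ Real.log (R / a) := by
      rw [← Real.log_div (by linarith) (by linarith)]
      refine Real.log_le_log (div_pos (by linarith) (by linarith)) ?_
      rw [div_le_div_iff₀ (by linarith) ha]; nlinarith
    simp only [sub_self, zero_div, Real.zero_rpow hs1.ne']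
    linarith
  · refine ContinuousOn.add ?_ (ContinuousOn.div_const ?_ _)
    · exact ContinuousOn.log (by fun_prop) fun x hx => (hq x hx.1).ne'
    · refine ContinuousOn.rpow_const (ContinuousOn.div (by fun_prop) (by fun_prop)
        fun x hx => (hq x hx.1).ne') fun _ _ => Or.inr (by linarith)
  · intro x hx
    have hx1 := hq x hx.1.le
    have hx2 : 0 < x - a := by linarith [hx.1]
    have d1 := ((hasDerivAt_id x).add_const a).log hx1.ne'
    have d2 := ((((hasDerivAt_id x).sub_const a).div ((hasDerivAt_id x).add_const a)
      hx1.ne').rpow_const (p := s + 1) (Or.inl (div_pos hx2 hx1).ne')).div_const (s + 1)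
    refine (d1.add d2).congr_deriv ?_
    simp only [id, add_sub_cancel_right, Pi.div_apply]
    field_simp
    ring
  · intro x hx
    have hx1 := hq x hx.1.le
    have hx2 : 0 < x - a := by linarith [hx.1]
    rw [norm_weight μ ν hx.1.ne' (by linarith), abs_of_pos hx1, abs_of_pos hx2, ← hs, ← hs']
    set Q := (x - a) / (x + a) with hQ
    have hQ0 : 0 < Q := div_pos hx2 hx1
    have hQ1 : Q ≤ 1 := (div_le_one hx1).2 (by linarith)
    have e1 : (x - a) ^ s * (x + a) ^ s' = Q ^ s / (x + a) := by
      rw [hQ, Real.div_rpow hx2.le hx1.le, show s' = -s - 1 by linarith, Real.rpow_sub_one hx1.ne',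
        Real.rpow_neg hx1.le]
      field_simp
    have e2 : 2 * a / (x + a) ^ 2 = (1 - Q) / (x + a) := by
      rw [hQ]; field_simp; ring
    have e3 : Q ^ s * Q ≤ 1 := by
      rw [← Real.rpow_add_one hQ0.ne']; exact Real.rpow_le_one hQ0.le hQ1 hs1.le
    rw [e1, e2, ← mul_div_assoc, ← add_div]
    gcongr
    linarith

/-- Hadamard averages `∫₀¹ θ ^ n * g (θ * x) dθ`. -/
noncomputable def hadamardAverage (n : ℕ) (g : ℝ → ℂ) (x : ℝ) : ℂ :=
  ∫ θ in (0 : ℝ)..1, (θ : ℂ) ^ n * g (θ * x)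

lemma hasDerivAt_hadamardAverage (n : ℕ) {g : ℝ → ℂ} (hg : ContDiff ℝ 1 g) (x : ℝ) :
    HasDerivAt (hadamardAverage n g) (hadamardAverage (n + 1) (deriv g) x) x := by
  have hg' : Continuous (deriv g) := hg.continuous_deriv le_rfl
  obtain ⟨M, hM⟩ := (isCompact_Icc (a := -(|x| + 1)) (b := |x| + 1)).exists_bound_of_continuousOn
    hg'.continuousOn
  refine (intervalIntegral.hasDerivAt_integral_of_dominated_loc_of_deriv_le
    (F := fun y θ => (θ : ℂ) ^ n * g (θ * y))
    (F' := fun y θ => (θ : ℂ) ^ (n + 1) * deriv g (θ * y)) (bound := fun _ => M)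
    (Metric.ball_mem_nhds x one_pos) ?_ ?_ ?_ ?_ ?_ ?_).2
  · refine Filter.Eventually.of_forall fun y => Continuous.aestronglyMeasurable ?_
    have := hg.continuous
    fun_prop
  · refine Continuous.intervalIntegrable ?_ _ _
    have := hg.continuous
    fun_prop
  · exact Continuous.aestronglyMeasurable (by fun_prop)
  · refine Filter.Eventually.of_forall fun θ hθ y hy => ?_
    rw [Set.uIoc_of_le zero_le_one] at hθ
    rw [Metric.mem_ball, Real.dist_eq] at hy
    have hy' : |θ * y| ≤ |x| + 1 := by
      rw [abs_mul, abs_of_pos hθ.1]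
      have : |y| ≤ |x| + 1 := by linarith [abs_sub_abs_le_abs_sub y x]
      nlinarith [abs_nonneg y, hθ.2]
    rw [norm_mul, norm_pow, Complex.norm_real, Real.norm_of_nonneg hθ.1.le]
    have h1 : θ ^ (n + 1) ≤ 1 := pow_le_one₀ hθ.1.le hθ.2
    calc _ ≤ 1 * ‖deriv g (θ * y)‖ := by gcongr
      _ ≤ M := by rw [one_mul]; exact hM _ (abs_le.1 hy')
  · exact intervalIntegrable_const
  · refine Filter.Eventually.of_forall fun θ _ y _ => ?_
    have h1 : HasDerivAt (fun y : ℝ => θ * y) θ y := by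
      simpa using (hasDerivAt_id y).const_mul θ
    have h2 := ((hg.differentiable one_ne_zero (θ * y)).hasDerivAt.scomp y h1).const_mul
      ((θ : ℂ) ^ n)
    refine h2.congr_deriv ?_
    rw [Complex.real_smul]; ring

lemma contDiff_hadamardAverage (n : ℕ) {g : ℝ → ℂ} (hg : ContDiff ℝ (⊤ : ℕ∞) g) :
    ContDiff ℝ (⊤ : ℕ∞) (hadamardAverage n g) := by
  have key : ∀ k : ℕ, ∀ n : ℕ, ∀ g : ℝ → ℂ, ContDiff ℝ (⊤ : ℕ∞) g →
      ContDiff ℝ k (hadamardAverage n g) := by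
    intro k
    induction k with
    | zero =>
      intro n g hg
      exact contDiff_zero.2 (continuous_iff_continuousAt.2 fun x =>
        (hasDerivAt_hadamardAverage n (hg.of_le (by exact_mod_cast le_top)) x).continuousAt)
    | succ k ih =>
      intro n g hg
      have hd := hasDerivAt_hadamardAverage n (hg.of_le (by exact_mod_cast le_top))
      push_cast
      rw [contDiff_succ_iff_deriv]
      refine ⟨fun x => (hd x).differentiableAt, by simp, ?_⟩
      rw [funext fun x => (hd x).deriv]
      exact ih _ _ (contDiff_infty_iff_deriv.1 hg).2
  exact contDiff_infty.2 fun k => key k n g hg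

/-- A smooth function is `ψ 0 + x * κ x` with `κ` smooth (the Hadamard lemma). -/
lemma exists_contDiff_eq_add_mul {ψ : ℝ → ℂ} (hψ : ContDiff ℝ (⊤ : ℕ∞) ψ) :
    ∃ κ : ℝ → ℂ, ContDiff ℝ (⊤ : ℕ∞) κ ∧ ∀ x, ψ x = ψ 0 + x * κ x := by
  have hψ' := (contDiff_infty_iff_deriv.1 hψ).2
  refine ⟨hadamardAverage 0 (deriv ψ), contDiff_hadamardAverage 0 hψ', fun x => ?_⟩
  have hc : Continuous (deriv ψ) := hψ'.continuous
  have h := intervalIntegral.integral_eq_sub_of_hasDerivAt (a := 0) (b := 1)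
    (f := fun θ : ℝ => ψ (θ * x)) (f' := fun θ => x * deriv ψ (θ * x)) ?_ ?_
  · rw [intervalIntegral.integral_const_mul] at h
    simp only [hadamardAverage, pow_zero, one_mul]
    rw [h]; simp
  · intro θ _
    have h1 : HasDerivAt (fun θ : ℝ => θ * x) x θ := by
      simpa using (hasDerivAt_id θ).mul_const x
    have := (contDiff_infty_iff_deriv.1 hψ).1 (θ * x) |>.hasDerivAt.scomp θ h1
    exact this.congr_deriv (by rw [Complex.real_smul])
  · exact Continuous.intervalIntegrable (by fun_prop) _ _

lemma norm_integral_weight_mul_le {a p q M : ℝ} {μ ν : ℂ} {f : ℝ → ℂ} (hpq : p ≤ q)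
    (hint : IntervalIntegrable (weight a μ ν) volume p q)
    (hf : ∀ x ∈ Set.Icc p q, ‖f x‖ ≤ M) :
    ‖∫ x in p..q, weight a μ ν x * f x‖ ≤ M * ∫ x in p..q, ‖weight a μ ν x‖ := by
  rw [← intervalIntegral.integral_const_mul]
  refine intervalIntegral.norm_integral_le_of_norm_le hpq ?_ (hint.norm.const_mul M)
  refine Filter.Eventually.of_forall fun x hx => ?_
  rw [norm_mul, mul_comm]
  exact mul_le_mul_of_nonneg_right (hf x (Set.Ioc_subset_Icc_self hx)) (norm_nonneg _)

/-- Double integration by parts on `[-a, a]`, uniformly in `a ≤ 1`. -/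
lemma exists_norm_integral_weight_inner_le (d : ℂ) {ψ : ℝ → ℂ} (hψ : ContDiff ℝ (⊤ : ℕ∞) ψ) :
    ∃ M, 0 ≤ M ∧ ∀ (a : ℝ) (μ ν : ℂ), 0 < a → a ≤ 1 → -1 < μ.re → -1 < ν.re →
      μ.re + ν.re = -1 → μ - ν = d →
      ‖(∫ x in (-a)..a, weight a μ ν x * ψ x) - ψ 0 * ∫ x in (-a)..a, weight a μ ν x‖ ≤
        M * (‖∫ x in (-a)..a, weight a μ ν x‖ / ‖μ + ν + 2‖ +
          (∫ x in (-a)..a, ‖weight a μ ν x‖) / ‖μ + ν + 2‖ ^ 2) := by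
  obtain ⟨κ, hκ, eκ⟩ := exists_contDiff_eq_add_mul hψ
  have hκ' := (contDiff_infty_iff_deriv.1 hκ).2
  have hκ'' := (contDiff_infty_iff_deriv.1 hκ').2
  obtain ⟨κ₂, hκ₂, eκ₂⟩ := exists_contDiff_eq_add_mul hκ
  have hκ₂' := (contDiff_infty_iff_deriv.1 hκ₂).2
  obtain ⟨κ₃, hκ₃, eκ₃⟩ := exists_contDiff_eq_add_mul hκ'
  have hκ₃' := (contDiff_infty_iff_deriv.1 hκ₃).2
  have c0 := hψ.continuous
  have c1 := hκ.continuous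
  have c2 := hκ'.continuous
  have c3 := hκ''.continuous
  have c4 := hκ₂.continuous
  have c5 := hκ₂'.continuous
  have c6 := hκ₃.continuous
  have c7 := hκ₃'.continuous
  let K : ℝ → ℝ → ℂ := fun a x => (a : ℂ) ^ 2 * κ₃ x - x * deriv κ x - a * d * κ₂ x
  let K' : ℝ → ℝ → ℂ := fun a x => (a : ℂ) ^ 2 * deriv κ₃ x - (deriv κ x + x * deriv (deriv κ) x) -
    a * d * deriv κ₂ x
  have hK : ∀ a x, HasDerivAt (K a) (K' a x) x := by
    intro a x
    have h1 := ((contDiff_infty_iff_deriv.1 hκ₃).1 x).hasDerivAt.const_mul ((a : ℂ) ^ 2)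
    have h2 := (hasDerivAt_id x).ofReal_comp.mul ((contDiff_infty_iff_deriv.1 hκ').1 x).hasDerivAt
    have h3 := ((contDiff_infty_iff_deriv.1 hκ₂).1 x).hasDerivAt.const_mul (a * d)
    refine ((h1.sub h2).sub h3).congr_deriv ?_
    simp [K']
  have hKc : ∀ a, Continuous (K a) := fun a => by simp only [K]; fun_prop
  have hK'c : ∀ a, Continuous (K' a) := fun a => by simp only [K']; fun_prop
  obtain ⟨M₁, hM₁⟩ := (isCompact_Icc (a := (0 : ℝ)) (b := 1)).exists_bound_of_continuousOn
    (f := fun a : ℝ => (a : ℂ) ^ 2 * deriv κ 0 - a * d * κ 0)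
    (Continuous.continuousOn (by fun_prop))
  obtain ⟨M₂, hM₂⟩ := ((isCompact_Icc (a := (0 : ℝ)) (b := 1)).prod
    (isCompact_Icc (a := (-1 : ℝ)) (b := 1))).exists_bound_of_continuousOn
    (f := fun p : ℝ × ℝ => ((p.1 : ℂ) ^ 2 - (p.2 : ℂ) ^ 2) * K' p.1 p.2 - p.1 * d * K p.1 p.2)
    (Continuous.continuousOn (by simp only [K, K']; fun_prop))
  refine ⟨max (max M₁ M₂) 0, le_max_right _ _, fun a μ ν ha ha1 hμ hν hsum hd => ?_⟩
  obtain ⟨hint, -⟩ := weight_inner ha hμ hν hsum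
  have hic : ∀ f : ℝ → ℂ, Continuous f →
      IntervalIntegrable (fun x => weight a μ ν x * f x) volume (-a) a :=
    fun f hf => hint.mul_continuousOn hf.continuousOn
  have hne : ∀ x ∈ Set.Ioo (-a) a, x ≠ a ∧ x ≠ -a := fun x hx => ⟨hx.2.ne, hx.1.ne'⟩
  have hp : weightPrimitive a μ ν (-a) = 0 := by simp [weightPrimitive]
  have hq : weightPrimitive a μ ν a = 0 := by simp [weightPrimitive]
  have e1 : (∫ x in (-a)..a, weight a μ ν x * ψ x) - ψ 0 * ∫ x in (-a)..a, weight a μ ν x =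
      ∫ x in (-a)..a, weight a μ ν x * (x * κ x) := by
    rw [← intervalIntegral.integral_const_mul, ← intervalIntegral.integral_sub (hic _ c0)
      (hint.const_mul _)]
    refine intervalIntegral.integral_congr fun x _ => ?_
    simp only [eκ x]; ring
  have e2 := integral_weight_mul_self_mul hμ hν (by linarith) hint hne
    (fun x _ => ((contDiff_infty_iff_deriv.1 hκ).1 x).hasDerivAt) c2.continuousOn
    (by rw [hp, zero_mul]) (by rw [hq, zero_mul])
  have e3 : ∫ x in (-a)..a, weight a μ ν x * (((a : ℂ) ^ 2 - (x : ℂ) ^ 2) * deriv κ x -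
        a * (μ - ν) * κ x) =
      ((a : ℂ) ^ 2 * deriv κ 0 - a * d * κ 0) * (∫ x in (-a)..a, weight a μ ν x) +
        ∫ x in (-a)..a, weight a μ ν x * (x * K a x) := by
    have hx : Continuous fun x : ℝ => (x : ℂ) * K a x := Complex.continuous_ofReal.mul (hKc a)
    rw [← intervalIntegral.integral_const_mul, ← intervalIntegral.integral_add
      (hint.const_mul _) (hic _ hx)]
    refine intervalIntegral.integral_congr fun x _ => ?_
    simp only [K, hd]
    linear_combination weight a μ ν x * ((a : ℂ) ^ 2 * eκ₃ x - a * d * eκ₂ x)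
  have e4 := integral_weight_mul_self_mul hμ hν (by linarith) hint hne
    (fun x _ => hK a x) (hK'c a).continuousOn (by rw [hp, zero_mul]) (by rw [hq, zero_mul])
  rw [hd] at e4
  have hc : μ + ν + 2 ≠ 0 := fun h => by
    have := congrArg Complex.re h
    simp at this
    linarith
  have hcn : 0 < ‖μ + ν + 2‖ := norm_pos_iff.2 hc
  have b1 : ‖(a : ℂ) ^ 2 * deriv κ 0 - a * d * κ 0‖ ≤ max (max M₁ M₂) 0 :=
    (hM₁ a ⟨ha.le, ha1⟩).trans (le_max_of_le_left (le_max_left _ _))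
  have b2 := norm_integral_weight_mul_le (M := max (max M₁ M₂) 0) (by linarith) hint
    (f := fun x => ((a : ℂ) ^ 2 - (x : ℂ) ^ 2) * K' a x - a * d * K a x)
    (fun x hx => (hM₂ (a, x) ⟨⟨ha.le, ha1⟩, ⟨by linarith [hx.1], by linarith [hx.2]⟩⟩).trans
      (le_max_of_le_left (le_max_right _ _)))
  rw [← e4] at b2
  rw [e3] at e2
  rw [e1, eq_div_of_mul_eq hc ((mul_comm _ _).trans e2), norm_div, div_le_iff₀ hcn]
  refine (norm_add_le _ _).trans ?_
  rw [norm_mul] at b2 ⊢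
  set J := ‖∫ x in (-a)..a, weight a μ ν x‖
  set I := ∫ x in (-a)..a, ‖weight a μ ν x‖
  set M := max (max M₁ M₂) 0
  have e5 : M * (J / ‖μ + ν + 2‖ + I / ‖μ + ν + 2‖ ^ 2) * ‖μ + ν + 2‖ =
    M * J + M * I / ‖μ + ν + 2‖ := by field_simp
  rw [e5]
  refine add_le_add (mul_le_mul_of_nonneg_right b1 (norm_nonneg _)) ?_
  rw [le_div_iff₀ hcn, mul_comm]
  exact b2

/-- Double integration by parts on `[a, R]`, uniformly in `a`. -/
lemma exists_norm_integral_weight_outer_le (d : ℂ) {ψ : ℝ → ℂ} (hψ : ContDiff ℝ (⊤ : ℕ∞) ψ)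
    {R : ℝ} (hR : ψ R = 0) (hR' : deriv ψ R = 0) :
    ∃ M, 0 ≤ M ∧ ∀ (a : ℝ) (μ ν : ℂ), 0 < a → a ≤ R → -1 < μ.re → -1 < ν.re →
      μ.re + ν.re = -1 → μ - ν = d →
      ‖∫ x in a..R, weight a μ ν x * ψ x‖ ≤
        M * (∫ x in a..R, ‖weight a μ ν x‖) / ‖μ + ν + 2‖ ^ 2 := by
  have hψ' := (contDiff_infty_iff_deriv.1 hψ).2
  have hψ'' := (contDiff_infty_iff_deriv.1 hψ').2
  have c0 := hψ.continuous
  have c1 := hψ'.continuous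
  have c2 := hψ''.continuous
  let g : ℝ → ℝ → ℂ := fun ρ x => ((ρ : ℂ) ^ 2 - 1) * (x * deriv ψ x - ψ x) - ρ * d * ψ x
  let h : ℝ → ℝ → ℂ := fun ρ x => -2 * (ρ : ℂ) ^ 2 * (x * deriv ψ x - ψ x) +
    ((ρ : ℂ) ^ 2 - 1) * ((x : ℂ) ^ 2 * deriv (deriv ψ) x) + ρ * d * (ψ x - x * deriv ψ x)
  have hgc : Continuous fun p : ℝ × ℝ => g p.1 p.2 := by simp only [g]; fun_prop
  have hhc : Continuous fun p : ℝ × ℝ => h p.1 p.2 := by simp only [h]; fun_prop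
  obtain ⟨M, hM⟩ := ((isCompact_Icc (a := (0 : ℝ)) (b := 1)).prod
    (isCompact_Icc (a := (0 : ℝ)) (b := R))).exists_bound_of_continuousOn
    (f := fun p : ℝ × ℝ => ((p.1 : ℂ) ^ 2 - 1) * (h p.1 p.2 - g p.1 p.2) - p.1 * d * g p.1 p.2)
    (Continuous.continuousOn (by fun_prop))
  refine ⟨max M 0, le_max_right _ _, fun a μ ν ha haR hμ hν hsum hd => ?_⟩
  obtain ⟨hint, -⟩ := weight_outer ha haR hμ hsum
  have hne : ∀ x ∈ Set.Ioo a R, x ≠ a ∧ x ≠ -a :=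
    fun x hx => ⟨hx.1.ne', (by linarith [hx.1] : -a < x).ne'⟩
  have hp : weightPrimitive a μ ν a = 0 := by simp [weightPrimitive]
  have hx0 : ∀ x ∈ Set.Icc a R, (x : ℂ) ≠ 0 := fun x hx =>
    Complex.ofReal_ne_zero.2 (ha.trans_le hx.1).ne'
  have hdiv : ContinuousOn (fun x : ℝ => a / x) (Set.Icc a R) :=
    continuousOn_const.div continuousOn_id fun x hx => (ha.trans_le hx.1).ne'
  have hg : ContinuousOn (fun x => g (a / x) x) (Set.Icc a R) :=
    Continuous.comp_continuousOn (g := fun p : ℝ × ℝ => g p.1 p.2) (f := fun x => (a / x, x)) hgc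
      (hdiv.prodMk continuousOn_id)
  have hh : ContinuousOn (fun x => h (a / x) x) (Set.Icc a R) :=
    Continuous.comp_continuousOn (g := fun p : ℝ × ℝ => h p.1 p.2) (f := fun x => (a / x, x)) hhc
      (hdiv.prodMk continuousOn_id)
  have hsq : ∀ x ∈ Set.Icc a R, (x : ℂ) ^ 2 ≠ 0 := fun x hx => pow_ne_zero 2 (hx0 x hx)
  have hdψ : ∀ x, HasDerivAt ψ (deriv ψ x) x :=
    fun x => ((contDiff_infty_iff_deriv.1 hψ).1 x).hasDerivAt
  have hdψ' : ∀ x, HasDerivAt (deriv ψ) (deriv (deriv ψ) x) x :=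
    fun x => ((contDiff_infty_iff_deriv.1 hψ').1 x).hasDerivAt
  have hid : ∀ x : ℝ, HasDerivAt (fun y : ℝ => (y : ℂ)) 1 x :=
    fun x => by simpa using (hasDerivAt_id x).ofReal_comp
  have e1 := integral_weight_mul_self_mul hμ hν haR hint hne
    (K := fun x => ψ x / x) (K' := fun x => (x * deriv ψ x - ψ x) / (x : ℂ) ^ 2)
    (fun x hx => ((hdψ x).div (hid x) (hx0 x hx)).congr_deriv (by ring))
    (ContinuousOn.div (Continuous.continuousOn (by fun_prop))
      (Continuous.continuousOn (by fun_prop)) hsq)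
    (by rw [hp, zero_mul]) (by simp [hR])
  have e1l : ∫ x in a..R, weight a μ ν x * (x * (ψ x / x)) =
      ∫ x in a..R, weight a μ ν x * ψ x := by
    refine intervalIntegral.integral_congr fun x hx => ?_
    rw [Set.uIcc_of_le haR] at hx
    simp only [mul_div_cancel₀ _ (hx0 x hx)]
  have hgd : ∀ x ∈ Set.Icc a R, HasDerivAt (fun x => g (a / x) x) (h (a / x) x / x) x := by
    intro x hx
    have q1 := ((hid x).inv (hx0 x hx)).const_mul (a : ℂ)
    have q2 := ((hid x).mul (hdψ' x)).sub (hdψ x)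
    have q := (((q1.pow 2).sub_const 1).mul q2).sub ((q1.mul_const d).mul (hdψ x))
    refine (q.congr_of_eventuallyEq (Filter.Eventually.of_forall fun y => ?_)).congr_deriv ?_
    · simp [g, div_eq_mul_inv]
    · have := hx0 x hx
      simp only [h]
      push_cast
      simp
      field_simp
      ring
  have e2 := integral_weight_mul_self_mul hμ hν haR hint hne
    (K := fun x => g (a / x) x / x) (K' := fun x => (h (a / x) x - g (a / x) x) / (x : ℂ) ^ 2)
    (fun x hx => ((hgd x hx).div (hid x) (hx0 x hx)).congr_deriv
      (by rw [div_mul_cancel₀ _ (hx0 x hx), mul_one]))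
    ((hh.sub hg).div (Continuous.continuousOn (by fun_prop)) hsq)
    (by rw [hp, zero_mul]) (by simp [g, hR, hR'])
  have e12 : ∫ x in a..R, weight a μ ν x * (((a : ℂ) ^ 2 - (x : ℂ) ^ 2) *
      ((x * deriv ψ x - ψ x) / (x : ℂ) ^ 2) - a * (μ - ν) * (ψ x / x)) =
      ∫ x in a..R, weight a μ ν x * (x * (g (a / x) x / x)) := by
    refine intervalIntegral.integral_congr fun x hx => ?_
    rw [Set.uIcc_of_le haR] at hx
    have := hx0 x hx
    simp only [g, hd]
    push_cast
    field_simp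
  have e3 : ∫ x in a..R, weight a μ ν x * (((a : ℂ) ^ 2 - (x : ℂ) ^ 2) *
      ((h (a / x) x - g (a / x) x) / (x : ℂ) ^ 2) - a * (μ - ν) * (g (a / x) x / x)) =
      ∫ x in a..R, weight a μ ν x * ((((a / x : ℝ) : ℂ) ^ 2 - 1) *
        (h (a / x) x - g (a / x) x) - ((a / x : ℝ) : ℂ) * d * g (a / x) x) := by
    refine intervalIntegral.integral_congr fun x hx => ?_
    rw [Set.uIcc_of_le haR] at hx
    have := hx0 x hx
    simp only [hd]
    generalize h (a / x) x = H
    generalize g (a / x) x = G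
    push_cast
    field_simp
  have b := norm_integral_weight_mul_le (M := max M 0) haR hint
    (f := fun x => (((a / x : ℝ) : ℂ) ^ 2 - 1) *
      (h (a / x) x - g (a / x) x) - ((a / x : ℝ) : ℂ) * d * g (a / x) x)
    (fun x hx => (hM (a / x, x) ⟨⟨div_nonneg ha.le (ha.le.trans hx.1),
      div_le_one_of_le₀ hx.1 (ha.le.trans hx.1)⟩, ⟨ha.le.trans hx.1, hx.2⟩⟩).trans
      (le_max_left _ _))
  have hc : μ + ν + 2 ≠ 0 := fun h => by
    have := congrArg Complex.re h
    simp at this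
    linarith
  rw [← e3, ← e2, ← e12, ← e1, e1l, ← mul_assoc, ← sq, norm_mul, norm_pow] at b
  rw [le_div_iff₀ (pow_pos (norm_pos_iff.2 hc) 2), mul_comm]
  exact b

lemma norm_pw_eq_one {z : ℂ} (a : ℝ) (hz : z.re = 0) : ‖pw a z‖ = 1 := by
  rw [pw, Complex.norm_exp, Complex.re_mul_ofReal, hz, zero_mul, Real.exp_zero]

section

variable {σ σ' : ℂ} {t : ℝ}

lemma le_norm_add_two (ht : 2 * (‖σ‖ + ‖σ'‖) + 1 ≤ t) :
    t ≤ ‖(σ + Complex.I * t) + (σ' + Complex.I * t) + 2‖ := by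
  refine le_trans ?_ (Complex.abs_im_le_norm _)
  refine le_trans ?_ (le_abs_self _)
  have h1 := (abs_le.1 (Complex.abs_im_le_norm σ)).1
  have h2 := (abs_le.1 (Complex.abs_im_le_norm σ')).1
  have h3 := norm_nonneg σ
  have h4 := norm_nonneg σ'
  simp
  linarith

lemma one_le_of_two_mul_norm_le (ht : 2 * (‖σ‖ + ‖σ'‖) + 1 ≤ t) : 1 ≤ t := by
  linarith [norm_nonneg σ, norm_nonneg σ']

end

lemma one_le_abs_log {a : ℝ} (ha : 0 < a) (ha' : a ≤ 0.1) : 1 ≤ |Real.log a| := by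
  rw [le_abs]
  right
  have h : Real.log a ≤ -1 := by
    rw [Real.log_le_iff_le_exp ha, Real.exp_neg]
    refine ha'.trans ?_
    rw [le_inv_comm₀ (by norm_num) (Real.exp_pos 1)]
    linarith [Real.exp_one_lt_d9]
  linarith

lemma exists_norm_integral_outer_le {σ σ' : ℂ} (hσ : -1 < σ.re) (hσ' : -1 < σ'.re)
    (hsum : σ.re + σ'.re = -1) {ψ : ℝ → ℂ} (hψ : ContDiff ℝ (⊤ : ℕ∞) ψ)
    {R : ℝ} (hR1 : 1 ≤ R) (hR : ψ R = 0) (hR' : deriv ψ R = 0) :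
    ∃ C, 0 ≤ C ∧ ∀ t : ℝ, 2 * (‖σ‖ + ‖σ'‖) + 1 ≤ t → ∀ a : ℝ, 0 < a → a ≤ 0.1 →
      ‖∫ x in a..R, weight a (σ + Complex.I * t) (σ' + Complex.I * t) x * ψ x‖ ≤
        C * |Real.log a| / t ^ 2 := by
  obtain ⟨M, hM0, hM⟩ := exists_norm_integral_weight_outer_le (σ - σ') hψ hR hR'
  have hlR : 0 ≤ Real.log R := Real.log_nonneg hR1
  have hs : 0 ≤ 1 / (σ.re + 1) := one_div_nonneg.2 (by linarith)
  refine ⟨M * (Real.log R + 1 + 1 / (σ.re + 1)), by positivity, fun t ht a ha ha' => ?_⟩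
  have ht1 := one_le_of_two_mul_norm_le ht
  have hc := le_norm_add_two ht
  have hl := one_le_abs_log ha ha'
  have haR : a ≤ R := ha'.trans (by linarith)
  have hre : ∀ s : ℂ, (s + Complex.I * t).re = s.re := fun s => by simp
  refine (hM a _ _ ha haR (by rwa [hre]) (by rwa [hre]) (by rwa [hre, hre]) (by ring)).trans ?_
  have hI := (weight_outer (μ := σ + Complex.I * t) (ν := σ' + Complex.I * t) ha haR
    (by rwa [hre]) (by rwa [hre, hre])).2
  rw [hre] at hI
  have hlog : Real.log (R / a) ≤ Real.log R + |Real.log a| := by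
    rw [Real.log_div (by linarith) ha.ne']
    linarith [neg_le_abs (Real.log a)]
  have hI' := hI.trans (add_le_add_left hlog _)
  rw [mul_assoc]
  gcongr
  refine hI'.trans ?_
  nlinarith

lemma exists_norm_integral_inner_sub_le {σ σ' : ℂ} (hσ : -1 < σ.re) (hσ' : -1 < σ'.re)
    (hsum : σ.re + σ'.re = -1) {ψ : ℝ → ℂ} (hψ : ContDiff ℝ (⊤ : ℕ∞) ψ) :
    ∃ C, 0 ≤ C ∧ ∀ t : ℝ, 2 * (‖σ‖ + ‖σ'‖) + 1 ≤ t → ∀ a : ℝ, 0 < a → a ≤ 1 →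
      ‖(∫ x in (-a)..a, weight a (σ + Complex.I * t) (σ' + Complex.I * t) x * ψ x) -
        pw a (σ + σ' + 1 + 2 * (Complex.I * t)) *
          ((√π : ℝ) * Complex.exp (-(π / 4 * Complex.I))) * ψ 0 * ((√t)⁻¹ : ℝ)‖ ≤
        C / (t * √t) := by
  obtain ⟨M, hM0, hM⟩ := exists_norm_integral_weight_inner_le (σ - σ') hψ
  obtain ⟨C, hC0, hC⟩ := gamma_ratio_asymptotics σ σ' hσ hσ' hsum
  set B := 2 / (σ.re + 1) + 2 / (σ'.re + 1) with hB
  have hB0 : 0 ≤ B := add_nonneg (div_nonneg zero_le_two (by linarith))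
    (div_nonneg zero_le_two (by linarith))
  refine ⟨M * (√π * (1 + C) + B) + ‖ψ 0‖ * (√π * C), by positivity, fun t ht a ha ha' => ?_⟩
  have ht1 := one_le_of_two_mul_norm_le ht
  have ht0 : 0 < t := by linarith
  have hst : 0 < √t := Real.sqrt_pos.2 ht0
  have hst' : √t ≤ t := by
    rw [Real.sqrt_le_left ht0.le]; nlinarith
  have hc := le_norm_add_two ht
  have hre : ∀ s : ℂ, (s + Complex.I * t).re = s.re := fun s => by simp
  have h1 := hM a (σ + Complex.I * t) (σ' + Complex.I * t) ha ha' (by rwa [hre]) (by rwa [hre])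
    (by rwa [hre, hre]) (by ring)
  have hI := (weight_inner (μ := σ + Complex.I * t) (ν := σ' + Complex.I * t) ha
    (by rwa [hre]) (by rwa [hre]) (by rwa [hre, hre])).2
  rw [hre, hre, ← hB] at hI
  have hJ := integral_weight (μ := σ + Complex.I * t) (ν := σ' + Complex.I * t) ha
    (by rwa [hre]) (by rwa [hre])
  have hG := hC t ht
  set P := pw a (σ + σ' + 1 + 2 * (Complex.I * t)) with hP
  have hPe : pw a (σ + Complex.I * t + (σ' + Complex.I * t) + 1) = P := by
    rw [hP]; congr 1; ring
  have hP1 : ‖P‖ = 1 := norm_pw_eq_one a (by simp; linarith)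
  rw [hPe] at hJ
  set J := ∫ x in (-a)..a, weight a (σ + Complex.I * t) (σ' + Complex.I * t) x
  set E := Complex.exp (-(π / 4 * Complex.I)) with hE
  have hE1 : ‖E‖ = 1 := by
    rw [hE, Complex.norm_exp]; simp
  have hsπ : ‖((√π : ℝ) : ℂ)‖ = √π := by
    rw [Complex.norm_real, Real.norm_of_nonneg (Real.sqrt_nonneg _)]
  have hJE : ‖J - P * (√π : ℝ) * (E * ((√t)⁻¹ : ℝ))‖ ≤ √π * C / (t * √t) := by
    rw [hJ, ← mul_sub, norm_mul, norm_mul, hP1, one_mul, hsπ, mul_div_assoc √π C]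
    exact mul_le_mul_of_nonneg_left hG (Real.sqrt_nonneg _)
  have hJn : ‖J‖ ≤ √π * (1 + C) / √t := by
    have h2 : ‖P * (√π : ℝ) * (E * ((√t)⁻¹ : ℝ))‖ = √π / √t := by
      rw [norm_mul, norm_mul, norm_mul, hP1, hE1, hsπ, Complex.norm_real,
        Real.norm_of_nonneg (by positivity)]
      ring
    have h3 : √π * C / (t * √t) ≤ √π * C / √t := by
      gcongr
      exact le_mul_of_one_le_left hst.le ht1
    have h4 := norm_add_le (J - P * (√π : ℝ) * (E * ((√t)⁻¹ : ℝ)))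
      (P * (√π : ℝ) * (E * ((√t)⁻¹ : ℝ)))
    rw [sub_add_cancel, h2] at h4
    have h5 : √π * (1 + C) / √t = √π * C / √t + √π / √t := by ring
    linarith
  have hb : M * (‖J‖ / ‖σ + Complex.I * t + (σ' + Complex.I * t) + 2‖ +
      (∫ x in (-a)..a, ‖weight a (σ + Complex.I * t) (σ' + Complex.I * t) x‖) /
        ‖σ + Complex.I * t + (σ' + Complex.I * t) + 2‖ ^ 2) ≤
      M * ((√π * (1 + C) + B) / (t * √t)) := by
    rw [add_div]
    refine mul_le_mul_of_nonneg_left (add_le_add ?_ ?_) hM0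
    · calc _ ≤ (√π * (1 + C) / √t) / t := by gcongr
        _ = _ := by rw [div_div, mul_comm √t]
    · calc _ ≤ B / t ^ 2 := by gcongr
        _ ≤ _ := by gcongr; nlinarith
  have e : (∫ x in (-a)..a, weight a (σ + Complex.I * t) (σ' + Complex.I * t) x * ψ x) -
      P * ((√π : ℝ) * E) * ψ 0 * ((√t)⁻¹ : ℝ) =
      ((∫ x in (-a)..a, weight a (σ + Complex.I * t) (σ' + Complex.I * t) x * ψ x) - ψ 0 * J) +
      ψ 0 * (J - P * (√π : ℝ) * (E * ((√t)⁻¹ : ℝ))) := by ring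
  rw [e]
  refine (norm_add_le _ _).trans ?_
  rw [norm_mul, add_div, mul_div_assoc, mul_div_assoc]
  gcongr
  exact h1.trans hb

lemma Cnorm_one_nonneg (ψ : ℝ → ℂ) : 0 ≤ Cnorm 1 ψ :=
  Real.iSup_nonneg fun _ => Real.iSup_nonneg fun _ => norm_nonneg _

lemma Cnorm_one_pos {ψ : ℝ → ℂ} (hψ : ContDiff ℝ (⊤ : ℕ∞) ψ) (hs : HasCompactSupport ψ)
    (h : ψ ≠ 0) : 0 < Cnorm 1 ψ := by
  obtain ⟨x, hx⟩ := Function.ne_iff.1 h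
  obtain ⟨M, hM⟩ := hs.exists_bound_of_continuous hψ.continuous
  have h1 : ‖ψ x‖ ≤ ⨆ x : ℝ, ‖iteratedDeriv ((0 : Fin 2) : ℕ) ψ x‖ := by
    refine le_ciSup_of_le ⟨M, ?_⟩ x (by simp)
    rintro _ ⟨y, rfl⟩
    simpa using hM y
  exact (norm_pos_iff.2 hx).trans_le
    (h1.trans (le_ciSup (f := fun m : Fin 2 => ⨆ x : ℝ, ‖iteratedDeriv (m : ℕ) ψ x‖)
      (Set.finite_range _).bddAbove 0))

lemma HasCompactSupport.exists_forall_le_abs {ψ : ℝ → ℂ} (hs : HasCompactSupport ψ) :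
    ∃ R, 1 ≤ R ∧ ∀ x, R ≤ |x| → ψ x = 0 ∧ deriv ψ x = 0 := by
  obtain ⟨r, hr⟩ := hs.isCompact.isBounded.subset_closedBall 0
  refine ⟨max r 0 + 1, by linarith [le_max_right r 0], fun x hx => ?_⟩
  have hx' : x ∉ tsupport ψ := fun h => by
    have := hr h
    rw [mem_closedBall_zero_iff, Real.norm_eq_abs] at this
    linarith [le_max_left r 0]
  exact ⟨image_eq_zero_of_notMem_tsupport hx',
    Function.notMem_support.1 fun h => hx' (support_deriv_subset h)⟩

lemma integral_weight_mul_eq {a R : ℝ} {μ ν : ℂ} (ha : 0 < a) (haR : a ≤ R) (hμ : -1 < μ.re)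
    (hν : -1 < ν.re) (hsum : μ.re + ν.re = -1) {ψ : ℝ → ℂ} (hψ : Continuous ψ)
    (hR : ∀ x, R ≤ |x| → ψ x = 0) :
    ∫ x, weight a μ ν x * ψ x = (∫ x in a..R, weight a ν μ x * ψ (-x)) +
      (∫ x in (-a)..a, weight a μ ν x * ψ x) + ∫ x in a..R, weight a μ ν x * ψ x := by
  have i1 : IntervalIntegrable (fun x => weight a ν μ x * ψ (-x)) volume a R :=
    (weight_outer ha haR hν (by linarith)).1.mul_continuousOn (by fun_prop)
  have i2 : IntervalIntegrable (fun x => weight a μ ν x * ψ x) volume (-a) a :=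
    (weight_inner ha hμ hν hsum).1.mul_continuousOn (by fun_prop)
  have i3 : IntervalIntegrable (fun x => weight a μ ν x * ψ x) volume a R :=
    (weight_outer ha haR hμ hsum).1.mul_continuousOn (by fun_prop)
  have e : (fun x => weight a ν μ x * ψ (-x)) = fun x => weight a μ ν (-x) * ψ (-x) := by
    simp only [weight_neg]
  have i1' : IntervalIntegrable (fun x => weight a μ ν x * ψ x) volume (-R) (-a) := by
    rw [e] at i1
    simpa using ((IntervalIntegrable.iff_comp_neg (f := fun x => weight a μ ν (-x) * ψ (-x))).1
      i1).symm
  rw [e, intervalIntegral.integral_comp_neg (fun x => weight a μ ν x * ψ x),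
    intervalIntegral.integral_add_adjacent_intervals i1' i2,
    intervalIntegral.integral_add_adjacent_intervals (i1'.trans i2) i3,
    intervalIntegral.integral_eq_integral_of_support_subset]
  intro x hx
  have : |x| < R := by
    by_contra! h
    exact hx (by simp [hR x h])
  exact ⟨(abs_lt.1 this).1, (abs_lt.1 this).2.le⟩

lemma norm_sqrt_pi_mul_exp : ‖(√π : ℝ) * Complex.exp (-(π / 4 * Complex.I))‖ = √π := by
  rw [norm_mul, Complex.norm_real, Complex.norm_exp, Real.norm_of_nonneg (Real.sqrt_nonneg _)]
  simp

/-- Stationary phase expansion of the scaled Beta integral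
`∫ |x-a|^{σ+λ} |x+a|^{σ'+λ} ψ(x) dx` for `λ = it`, with main term
`a^{σ+σ'+1+2λ} α ψ(0) |λ|^{-1/2}`, whose modulus is `√π |ψ(0)| |λ|^{-1/2}`. -/
theorem stmt_4 (σ σ' : ℂ) (hσ : -1 < σ.re) (hσ' : -1 < σ'.re)
    (hsum : σ.re + σ'.re = -1) :
    ∃ α : ℂ, ‖α‖ = Real.sqrt π ∧
      ∀ ψ : ℝ → ℂ, ContDiff ℝ (⊤ : ℕ∞) ψ → HasCompactSupport ψ →
        ∃ C₃ C₄ : ℝ, 0 < C₃ ∧ 0 < C₄ ∧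
          ∀ t : ℝ, 2 * (‖σ‖ + ‖σ'‖) + 1 ≤ t → ∀ a : ℝ, a ∈ Set.Ioc (0 : ℝ) 0.1 →
            ‖(∫ x : ℝ, pw |x - a| (σ + Complex.I * (t : ℂ)) *
                  pw |x + a| (σ' + Complex.I * (t : ℂ)) * ψ x) -
                pw a (σ + σ' + 1 + 2 * (Complex.I * (t : ℂ))) * α * ψ 0 *
                  ((‖Complex.I * (t : ℂ)‖ ^ (-(1 / 2) : ℝ) : ℝ) : ℂ)‖ ≤
              C₃ * Cnorm 1 ψ * ‖Complex.I * (t : ℂ)‖ ^ (-(3 / 2) : ℝ) +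
              C₄ * |Real.log a| * ‖Complex.I * (t : ℂ)‖ ^ (-2 : ℝ) ∧
            ‖pw a (σ + σ' + 1 + 2 * (Complex.I * (t : ℂ))) * α * ψ 0 *
                ((‖Complex.I * (t : ℂ)‖ ^ (-(1 / 2) : ℝ) : ℝ) : ℂ)‖ =
              Real.sqrt π * ‖ψ 0‖ * ‖Complex.I * (t : ℂ)‖ ^ (-(1 / 2) : ℝ) := by
  refine ⟨(√π : ℝ) * Complex.exp (-(π / 4 * Complex.I)), ?_, fun ψ hψ hs => ?_⟩
  · exact norm_sqrt_pi_mul_exp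
  obtain ⟨C, C', hC, hC', h⟩ : ∃ C C' : ℝ, 0 ≤ C ∧ 0 ≤ C' ∧ ∀ t : ℝ, 2 * (‖σ‖ + ‖σ'‖) + 1 ≤ t →
      ∀ a : ℝ, 0 < a → a ≤ 0.1 →
      ‖(∫ x, weight a (σ + Complex.I * t) (σ' + Complex.I * t) x * ψ x) -
        pw a (σ + σ' + 1 + 2 * (Complex.I * t)) *
          ((√π : ℝ) * Complex.exp (-(π / 4 * Complex.I))) * ψ 0 * ((√t)⁻¹ : ℝ)‖ ≤
        C / (t * √t) + C' * |Real.log a| / t ^ 2 := by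
    obtain ⟨R, hR1, hR⟩ := hs.exists_forall_le_abs
    have hRR := hR R (le_abs_self R)
    have hRn := hR (-R) (by rw [abs_neg]; exact le_abs_self R)
    obtain ⟨C, hC, h⟩ := exists_norm_integral_inner_sub_le hσ hσ' hsum hψ
    obtain ⟨C₁, hC₁, h₁⟩ := exists_norm_integral_outer_le hσ hσ' hsum hψ hR1 hRR.1 hRR.2
    obtain ⟨C₂, hC₂, h₂⟩ := exists_norm_integral_outer_le hσ' hσ (by linarith)
      (hψ.comp contDiff_neg) hR1 hRn.1 (by
        have := deriv_comp_neg ψ R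
        rw [hRn.2, neg_zero] at this
        exact this)
    refine ⟨C, C₂ + C₁, hC, by positivity, fun t ht a ha ha' => ?_⟩
    have hre : ∀ s : ℂ, (s + Complex.I * t).re = s.re := fun s => by simp
    rw [integral_weight_mul_eq ha (ha'.trans (by linarith)) (by rwa [hre]) (by rwa [hre])
      (by rwa [hre, hre]) hψ.continuous fun x hx => (hR x hx).1]
    have b := h t ht a ha (ha'.trans (by norm_num))
    have b₁ := h₁ t ht a ha ha'
    have b₂ := h₂ t (by linarith) a ha ha'
    rw [add_sub_right_comm, add_sub_assoc]
    refine (norm_add₃_le).trans ?_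
    simp only [Function.comp_apply] at b₂
    rw [add_mul, add_div]
    linarith
  have hI : ∀ t : ℝ, 2 * (‖σ‖ + ‖σ'‖) + 1 ≤ t → ‖Complex.I * (t : ℂ)‖ = t ∧
      t ^ (-(1 / 2) : ℝ) = (√t)⁻¹ ∧ t ^ (-(3 / 2) : ℝ) = (t * √t)⁻¹ ∧
      t ^ (-2 : ℝ) = (t ^ 2)⁻¹ := by
    intro t ht
    have ht0 : 0 < t := zero_lt_one.trans_le (one_le_of_two_mul_norm_le ht)
    refine ⟨by simp [ht0.le], ?_, ?_, ?_⟩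
    · rw [Real.rpow_neg ht0.le, Real.sqrt_eq_rpow]
    · rw [Real.rpow_neg ht0.le, Real.sqrt_eq_rpow, ← Real.rpow_one_add' ht0.le (by norm_num)]
      norm_num
    · rw [Real.rpow_neg ht0.le]
      norm_num
  have main : ∀ (t a : ℝ), ‖pw a (σ + σ' + 1 + 2 * (Complex.I * t)) *
      ((√π : ℝ) * Complex.exp (-(π / 4 * Complex.I))) * ψ 0 * ((√t)⁻¹ : ℝ)‖ =
      √π * ‖ψ 0‖ * (√t)⁻¹ := by
    intro t a
    rw [norm_mul, norm_mul, norm_mul, norm_sqrt_pi_mul_exp,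
      norm_pw_eq_one a (by simp; linarith), one_mul, Complex.norm_real,
      Real.norm_of_nonneg (by positivity)]
  obtain ⟨C₃, hC₃, hle⟩ : ∃ C₃, 0 < C₃ ∧ (ψ ≠ 0 → C ≤ C₃ * Cnorm 1 ψ) := by
    rcases eq_or_ne ψ 0 with h0 | h0
    · exact ⟨1, one_pos, fun hn => absurd h0 hn⟩
    · have hp := Cnorm_one_pos hψ hs h0
      refine ⟨(C + 1) / Cnorm 1 ψ, by positivity, fun _ => ?_⟩
      rw [div_mul_cancel₀ _ hp.ne']
      linarith
  refine ⟨C₃, C' + 1, hC₃, by positivity, fun t ht a ha => ?_⟩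
  obtain ⟨e0, e1, e2, e3⟩ := hI t ht
  have ht0 : 0 < t := zero_lt_one.trans_le (one_le_of_two_mul_norm_le ht)
  rw [e0, e1, e2, e3]
  refine ⟨?_, main t a⟩
  have hn := Cnorm_one_nonneg ψ
  rcases eq_or_ne ψ 0 with h0 | h0
  · simp only [h0, Pi.zero_apply, mul_zero, zero_mul, integral_zero, sub_self, norm_zero]
    rw [h0] at hn
    positivity
  · refine (h t ht a ha.1 ha.2).trans ?_
    rw [div_eq_mul_inv, div_eq_mul_inv]
    have h3 := hle h0
    gcongr
    linarith
end

section
/- Let h : ℝ → ℝ be a smooth function with h(0) = 0 and h'(t) > 0 for all t, and set f(t, c) = h(t − c)·h(t + c). Then there exist a neighborhood U of (0, 0) in ℝ², smooth real-valued functions x(t, c) and a(c) on U (with a depending only on c), and smooth functions g₁, g₂ defined and nonvanishing on a neighborhood of (0, 0), such that: (1) the map (t, c) ↦ (x(t, c), a(c)) is a diffeomorphism from U onto its image; (2) f(t, c) = (x(t,c) + a(c))·(x(t,c) − a(c)) on U; (3) h(t − c) = (x(t,c) − a(c))·g₁(x(t,c), a(c)) and h(t + c) = (x(t,c) + a(c))·g₂(x(t,c),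 a(c)) on U. -/
open MeasureTheory

theorem contDiff_parametric_integral_nat {E : Type} [NormedAddCommGroup E] [NormedSpace ℝ E]
    [ProperSpace E] (n : ℕ) : ∀ {F : Type} [NormedAddCommGroup F] [NormedSpace ℝ F]
    [CompleteSpace F] {G : E × ℝ → F}, ContDiff ℝ n G →
    ContDiff ℝ n (fun p => ∫ r in (0 : ℝ)..1, G (p, r)) := by
  induction n with
  | zero =>
    intro F _ _ _ G hG
    have hc : Continuous G := hG.continuous
    exact contDiff_zero.2
      (intervalIntegral.continuous_parametric_intervalIntegral_of_continuous' (by fun_prop) 0 1)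
  | succ n ih =>
    intro F _ _ _ G hG
    have hG1 : ContDiff ℝ 1 G := hG.of_le (by norm_cast; omega)
    have hc : Continuous G := hG.continuous
    set G' : E × ℝ → E →L[ℝ] F :=
      fun q => (fderiv ℝ G q).comp (ContinuousLinearMap.inl ℝ E ℝ) with hG'
    have hG's : ContDiff ℝ n G' :=
      (hG.fderiv_right (m := n) (by norm_cast)).clm_comp contDiff_const
    have hc' : Continuous G' := hG's.continuous
    have key : ∀ p, HasFDerivAt (fun p => ∫ r in (0 : ℝ)..1, G (p, r))
        (∫ r in (0 : ℝ)..1, G' (p, r)) p := by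
      intro p
      obtain ⟨C, hC⟩ := ((isCompact_closedBall p 1).prod
        (isCompact_Icc (a := (0 : ℝ)) (b := 1))).exists_bound_of_continuousOn hc'.continuousOn
      refine intervalIntegral.hasFDerivAt_integral_of_dominated_of_fderiv_le (𝕜 := ℝ)
        (F := fun p r => G (p, r)) (F' := fun p r => G' (p, r)) (bound := fun _ => C)
        (Metric.ball_mem_nhds p one_pos) ?_ ?_ ?_ ?_ ?_ ?_
      · exact Filter.Eventually.of_forall fun q =>
          (by fun_prop : Continuous fun r => G (q, r)).aestronglyMeasurable
      · exact (by fun_prop : Continuous fun r => G (p, r)).intervalIntegrable _ _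
      · exact (by fun_prop : Continuous fun r => G' (p, r)).aestronglyMeasurable
      · refine Filter.Eventually.of_forall fun r hr q hq => hC (q, r) ⟨?_, ?_⟩
        · exact Metric.ball_subset_closedBall hq
        · rw [Set.uIoc_of_le zero_le_one] at hr
          exact Set.Ioc_subset_Icc_self hr
      · exact intervalIntegrable_const
      · refine Filter.Eventually.of_forall fun r hr q hq => ?_
        have h1 : HasFDerivAt G (fderiv ℝ G (q, r)) (q, r) :=
          (hG1.differentiable one_ne_zero _).hasFDerivAt
        exact h1.comp q (hasFDerivAt_prodMk_left q r)
    rw [Nat.cast_succ, contDiff_succ_iff_fderiv]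
    refine ⟨fun p => (key p).differentiableAt, by simp, ?_⟩
    rw [show fderiv ℝ (fun p => ∫ r in (0 : ℝ)..1, G (p, r)) =
      fun p => ∫ r in (0 : ℝ)..1, G' (p, r) from funext fun p => (key p).fderiv]
    exact ih hG's

/-- Hadamard's lemma with parameters: the divided difference of a smooth function in its first
variable is smooth. -/
theorem exists_contDiff_dividedDifference {E : Type} [NormedAddCommGroup E] [NormedSpace ℝ E]
    [FiniteDimensional ℝ E] {G : ℝ × E → ℝ} (hG : ContDiff ℝ (⊤ : ℕ∞) G) :
    ∃ D : ℝ × ℝ × E → ℝ, ContDiff ℝ (⊤ : ℕ∞) D ∧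
      ∀ t s e, G (t, e) - G (s, e) = (t - s) * D (t, s, e) := by
  have : ProperSpace E := FiniteDimensional.proper ℝ E
  set G' : ℝ × E → ℝ := fun q => fderiv ℝ G q (1, 0) with hG'
  have hG's : ContDiff ℝ (⊤ : ℕ∞) G' :=
    (hG.fderiv_right (m := (⊤ : ℕ∞)) (by norm_cast)).clm_apply contDiff_const
  refine ⟨fun q => ∫ r in (0 : ℝ)..1, G' (q.2.1 + r * (q.1 - q.2.1), q.2.2), ?_, ?_⟩
  · rw [contDiff_infty]
    intro n
    refine contDiff_parametric_integral_nat n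
      (G := fun q : (ℝ × ℝ × E) × ℝ => G' (q.1.2.1 + q.2 * (q.1.1 - q.1.2.1), q.1.2.2)) ?_
    exact (contDiff_infty.1 hG's n).comp (by fun_prop)
  · intro t s e
    have hd : ∀ r : ℝ, HasDerivAt (fun r : ℝ => G (s + r * (t - s), e))
        ((t - s) * G' (s + r * (t - s), e)) r := by
      intro r
      have h1 : HasFDerivAt G (fderiv ℝ G (s + r * (t - s), e)) (s + r * (t - s), e) :=
        (hG.differentiable (by simp) _).hasFDerivAt
      have h2 : HasDerivAt (fun r : ℝ => (s + r * (t - s), e)) ((t - s), (0 : E)) r := by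
        have := (((hasDerivAt_id r).mul_const (t - s)).const_add s).prodMk (hasDerivAt_const r e)
        simpa using this
      have h3 := h1.comp_hasDerivAt r h2
      have h4 : ((t - s), (0 : E)) = (t - s) • ((1 : ℝ), (0 : E)) := by simp
      rw [h4, map_smul] at h3
      exact h3
    have hcG' : Continuous G' := hG's.continuous
    have := intervalIntegral.integral_eq_sub_of_hasDerivAt (fun r _ => hd r)
      ((by fun_prop : Continuous fun r => (t - s) * G' (s + r * (t - s), e)).intervalIntegrable 0 1)
    rw [intervalIntegral.integral_const_mul] at this
    simpa using this.symm

/-- Smooth inverse function theorem in the plane, with smoothness of the inverse on all of the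
target. -/
theorem exists_openPartialHomeomorph_contDiffOn {Ψ : ℝ × ℝ → ℝ × ℝ} {p : ℝ × ℝ}
    {L : ℝ × ℝ →L[ℝ] ℝ × ℝ} {V : Set (ℝ × ℝ)} (hV : V ∈ nhds p)
    (hΨ : ∀ q ∈ V, ContDiffAt ℝ (⊤ : ℕ∞) Ψ q) (hL : HasFDerivAt Ψ L p)
    (hinj : ∀ v, L v = 0 → v = 0) :
    ∃ e : OpenPartialHomeomorph (ℝ × ℝ) (ℝ × ℝ), (∀ q, e q = Ψ q) ∧ p ∈ e.source ∧
      e.source ⊆ V ∧ ContDiffOn ℝ (⊤ : ℕ∞) e.symm e.target ∧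
      ∀ q ∈ e.source, ∃ M : (ℝ × ℝ) ≃L[ℝ] (ℝ × ℝ),
        HasFDerivAt Ψ (M : (ℝ × ℝ) →L[ℝ] (ℝ × ℝ)) q := by
  have hΨp : ContDiffAt ℝ (⊤ : ℕ∞) Ψ p := hΨ p (mem_of_mem_nhds hV)
  have hinj' : Function.Injective L.toLinearMap :=
    (injective_iff_map_eq_zero _).2 hinj
  set M₀ : (ℝ × ℝ) ≃L[ℝ] (ℝ × ℝ) :=
    (LinearEquiv.ofInjectiveEndo L.toLinearMap hinj').toContinuousLinearEquiv with hM₀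
  have hM₀L : (M₀ : (ℝ × ℝ) →L[ℝ] (ℝ × ℝ)) = L := by
    ext <;> rfl
  have hM₀p : HasFDerivAt Ψ (M₀ : (ℝ × ℝ) →L[ℝ] (ℝ × ℝ)) p := by rwa [hM₀L]
  have hne : ((⊤ : ℕ∞) : WithTop ℕ∞) ≠ 0 := by simp
  set e₀ := hΨp.toOpenPartialHomeomorph Ψ hM₀p hne with he₀
  have hcont : ContinuousAt (fderiv ℝ Ψ) p :=
    (hΨp.fderiv_right (m := 0) (by norm_cast)).continuousAt
  have hev : ∀ᶠ q in nhds p, fderiv ℝ Ψ q ∈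
      Set.range ((↑) : ((ℝ × ℝ) ≃L[ℝ] (ℝ × ℝ)) → (ℝ × ℝ) →L[ℝ] (ℝ × ℝ)) := by
    refine hcont.eventually_mem (ContinuousLinearEquiv.isOpen.mem_nhds ?_)
    exact ⟨M₀, hM₀p.fderiv.symm⟩
  obtain ⟨S, hS, hSo, hpS⟩ := mem_nhds_iff.1 (Filter.inter_mem hev hV)
  have hder : ∀ q ∈ S, ∃ M : (ℝ × ℝ) ≃L[ℝ] (ℝ × ℝ),
      HasFDerivAt Ψ (M : (ℝ × ℝ) →L[ℝ] (ℝ × ℝ)) q := by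
    intro q hq
    obtain ⟨M, hM⟩ := (hS hq).1
    refine ⟨M, ?_⟩
    rw [hM]
    exact ((hΨ q (hS hq).2).differentiableAt hne).hasFDerivAt
  have hsrc : (e₀.restrOpen S hSo).source = e₀.source ∩ S := rfl
  refine ⟨e₀.restrOpen S hSo, fun q => rfl, ?_, ?_, ?_, ?_⟩
  · exact ⟨hΨp.mem_toOpenPartialHomeomorph_source hM₀p hne, hpS⟩
  · exact fun q hq => (hS hq.2).2
  · intro y hy
    have hq := (e₀.restrOpen S hSo).map_target hy
    obtain ⟨M, hM⟩ := hder _ hq.2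
    exact ((e₀.restrOpen S hSo).contDiffAt_symm hy hM (hΨ _ (hS hq.2).2)).contDiffWithinAt
  · exact fun q hq => hder q hq.2

theorem hasDerivAt_of_dividedDifference {E : Type} [NormedAddCommGroup E] [NormedSpace ℝ E]
    {G : ℝ × E → ℝ} {D : ℝ × ℝ × E → ℝ} (hD : ContDiff ℝ (⊤ : ℕ∞) D)
    (hGD : ∀ t s e, G (t, e) - G (s, e) = (t - s) * D (t, s, e)) (s : ℝ) (e : E) :
    HasDerivAt (fun t => G (t, e)) (D (s, s, e)) s := by
  have hd : Differentiable ℝ D := hD.differentiable (by simp)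
  have h1 : DifferentiableAt ℝ (fun t => D (t, s, e)) s := by fun_prop
  have h2 := (((hasDerivAt_id s).sub_const s).mul h1.hasDerivAt).const_add (G (s, e))
  have h3 : (fun t => G (t, e)) =
      fun t => G (s, e) + ((fun t => id t - s) * fun t => D (t, s, e)) t := by
    funext t
    have := hGD t s e
    simp only [Pi.mul_apply, id]
    linarith
  rw [h3]
  simpa using h2

theorem exists_pos_factor {h : ℝ → ℝ} (hsm : ContDiff ℝ (⊤ : ℕ∞) h) (h0 : h 0 = 0)
    (hpos : ∀ t : ℝ, 0 < deriv h t) :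
    ∃ H : ℝ → ℝ, ContDiff ℝ (⊤ : ℕ∞) H ∧ (∀ y, h y = y * H y) ∧ (∀ y, 0 < H y) ∧
      deriv h 0 = H 0 := by
  obtain ⟨D, hD, hDeq⟩ := exists_contDiff_dividedDifference (E := ℝ)
    (G := fun q => h q.1) (hsm.comp contDiff_fst)
  have hfac : ∀ y, h y = y * D (y, 0, 0) := fun y => by simpa [h0] using hDeq y 0 0
  have hd0 : deriv h 0 = D (0, 0, 0) := 
    (hasDerivAt_of_dividedDifference (G := fun q => h q.1) hD hDeq 0 0).deriv
  have hmono : StrictMono h := strictMono_of_deriv_pos hpos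
  refine ⟨fun y => D (y, 0, 0), hD.comp (by fun_prop), hfac, fun y => ?_, hd0⟩
  rcases lt_trichotomy y 0 with hy | rfl | hy
  · have h1 := hmono hy
    rw [h0, hfac y] at h1
    exact pos_of_mul_neg_right h1 hy.le
  · exact hd0.subst (motive := fun z => 0 < z) (hpos 0)
  · have h1 := hmono hy
    rw [h0, hfac y] at h1
    exact pos_of_mul_pos_right h1 hy.le

theorem exists_smooth_implicit {Φ : ℝ × ℝ → ℝ} {d : ℝ} (hΦ : ContDiff ℝ (⊤ : ℕ∞) Φ)
    (h0 : Φ (0, 0) = 0) (hd : HasDerivAt (fun s => Φ (s, 0)) d 0) (hne : d ≠ 0) :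
    ∃ σ : ℝ → ℝ, σ 0 = 0 ∧ ∀ᶠ c in nhds 0, ContDiffAt ℝ (⊤ : ℕ∞) σ c ∧ Φ (σ c, c) = 0 := by
  have hΨ : ContDiff ℝ (⊤ : ℕ∞) fun p : ℝ × ℝ => (Φ p, p.2) := hΦ.prodMk contDiff_snd
  have hΦd : HasFDerivAt Φ (fderiv ℝ Φ (0, 0)) (0, 0) :=
    (hΦ.differentiable (by simp) _).hasFDerivAt
  have hcurve : HasDerivAt (fun s : ℝ => (s, (0 : ℝ))) ((1 : ℝ), (0 : ℝ)) 0 :=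
    (hasDerivAt_id (0 : ℝ)).prodMk (hasDerivAt_const (0 : ℝ) (0 : ℝ))
  have hdir : fderiv ℝ Φ (0, 0) (1, 0) = d :=
    (HasFDerivAt.comp_hasDerivAt (f := fun s : ℝ => (s, (0 : ℝ))) 0 hΦd hcurve).unique hd
  obtain ⟨e, he, h0s, -, hsymm, -⟩ := exists_openPartialHomeomorph_contDiffOn
    (Ψ := fun p : ℝ × ℝ => (Φ p, p.2)) (p := (0, 0)) Filter.univ_mem
    (fun q _ => hΨ.contDiffAt) (hΦd.prodMk hasFDerivAt_snd) (by
      rintro ⟨v, w⟩ hv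
      simp only [ContinuousLinearMap.prod_apply, ContinuousLinearMap.coe_snd', Prod.mk_eq_zero]
        at hv
      obtain ⟨hv, rfl⟩ := hv
      have h1 : ((v, 0) : ℝ × ℝ) = v • ((1 : ℝ), (0 : ℝ)) := by simp
      rw [h1, map_smul, hdir, smul_eq_mul] at hv
      simp [(mul_eq_zero.1 hv).resolve_right hne])
  have he0 : e (0, 0) = (0, 0) := by rw [he]; simp [h0]
  have h0t : ((0 : ℝ), (0 : ℝ)) ∈ e.target := he0 ▸ e.map_source h0s
  refine ⟨fun c => (e.symm (0, c)).1, ?_, ?_⟩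
  · have := e.left_inv h0s
    rw [he0] at this
    simp [this]
  · have hc : Continuous fun c : ℝ => ((0 : ℝ), c) := by fun_prop
    filter_upwards [hc.continuousAt.preimage_mem_nhds (e.open_target.mem_nhds h0t)] with c hct
    constructor
    · have h1 : ContDiffAt ℝ (⊤ : ℕ∞) e.symm (0, c) :=
        hsymm.contDiffAt (e.open_target.mem_nhds hct)
      exact contDiffAt_fst.comp c (h1.comp c (by fun_prop))
    · have h1 := e.right_inv hct
      rw [he] at h1
      have h2 : (e.symm (0, c)).2 = c := congrArg Prod.snd h1
      have h3 : Φ (e.symm (0, c)) = 0 := congrArg Prod.fst h1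
      rwa [← h2, h2, show ((e.symm (0, c)).1, c) = e.symm (0, c) from Prod.ext rfl h2.symm]

theorem exists_second_order_remainder {h H : ℝ → ℝ} (hsm : ContDiff ℝ (⊤ : ℕ∞) h)
    (hH : ContDiff ℝ (⊤ : ℕ∞) H) (hfac : ∀ y, h y = y * H y) :
    ∃ K : ℝ × ℝ × ℝ → ℝ, ContDiff ℝ (⊤ : ℕ∞) K ∧ K (0, 0, 0) = H 0 ^ 2 ∧
      ∀ t s c, h (t - c) * h (t + c) = h (s - c) * h (s + c) +
        (t - s) * (deriv h (s - c) * h (s + c) + h (s - c) * deriv h (s + c)) +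
        (t - s) ^ 2 * K (t, s, c) := by
  obtain ⟨D, hD, hDeq⟩ := exists_contDiff_dividedDifference (E := ℝ)
    (G := fun q => h (q.1 - q.2) * h (q.1 + q.2))
    ((hsm.comp (by fun_prop)).mul (hsm.comp (by fun_prop)))
  obtain ⟨D₂, hD₂, hD₂eq⟩ := exists_contDiff_dividedDifference hD
  have hdiag : ∀ s c, D (s, s, c) =
      deriv h (s - c) * h (s + c) + h (s - c) * deriv h (s + c) := by
    intro s c
    have hd : ∀ y, HasDerivAt h (deriv h y) y :=
      fun y => (hsm.differentiable (by simp) y).hasDerivAt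
    have h1 := hasDerivAt_of_dividedDifference
      (G := fun q => h (q.1 - q.2) * h (q.1 + q.2)) hD hDeq s c
    exact h1.unique (((hd (s - c)).comp_sub_const s c).mul ((hd (s + c)).comp_add_const s c))
  have hexp : ∀ t s c, h (t - c) * h (t + c) = h (s - c) * h (s + c) +
        (t - s) * (deriv h (s - c) * h (s + c) + h (s - c) * deriv h (s + c)) +
        (t - s) ^ 2 * D₂ (t, s, s, c) := by
    intro t s c
    have h1 := hDeq t s c
    have h2 := hD₂eq t s (s, c)
    rw [hdiag] at h2
    simp only at h1
    linear_combination h1 + (t - s) * h2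
  refine ⟨fun q => D₂ (q.1, q.2.1, q.2.1, q.2.2), hD₂.comp (by fun_prop), ?_, hexp⟩
  have hc₁ : Continuous fun t => D₂ (t, 0, 0, 0) := hD₂.continuous.comp (by fun_prop)
  have hc₂ : Continuous fun t => H t ^ 2 := hH.continuous.pow 2
  have heq : Set.EqOn (fun t => D₂ (t, 0, 0, 0)) (fun t => H t ^ 2) {0}ᶜ := by
    intro t ht
    have h1 := hexp t 0 0
    have h2 := hfac t
    have h3 := hfac 0
    simp only [sub_zero, add_zero, h2, h3] at h1
    have h4 : t ^ 2 * (D₂ (t, 0, 0, 0) - H t ^ 2) = 0 := by linear_combination -h1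
    have h5 := (mul_eq_zero.1 h4).resolve_left (pow_ne_zero 2 ht)
    simpa [sub_eq_zero] using h5
  exact congrFun (hc₁.ext_on (dense_compl_singleton 0) hc₂ heq) 0

theorem exists_critical_slope {h H : ℝ → ℝ} (hsm : ContDiff ℝ (⊤ : ℕ∞) h)
    (hH : ContDiff ℝ (⊤ : ℕ∞) H) (hfac : ∀ y, h y = y * H y) (hH0 : H 0 ≠ 0)
    (hd0 : deriv h 0 = H 0) :
    ∃ σ : ℝ → ℝ, σ 0 = 0 ∧ ∀ᶠ c in nhds 0, ContDiffAt ℝ (⊤ : ℕ∞) σ c ∧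
      deriv h (c * σ c - c) * h (c * σ c + c) + h (c * σ c - c) * deriv h (c * σ c + c) = 0 := by
  have hh' : ContDiff ℝ (⊤ : ℕ∞) (deriv h) := (contDiff_infty_iff_deriv.1 hsm).2
  obtain ⟨σ, hσ0, hσ⟩ := exists_smooth_implicit
    (Φ := fun p => deriv h (p.2 * p.1 - p.2) * ((p.1 + 1) * H (p.2 * p.1 + p.2)) +
      (p.1 - 1) * H (p.2 * p.1 - p.2) * deriv h (p.2 * p.1 + p.2)) (d := 2 * H 0 ^ 2)
    (by fun_prop) (by simp; ring)
    (by
      have h1 := ((hasDerivAt_id (0 : ℝ)).const_mul (2 * H 0 ^ 2))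
      simp only [mul_one] at h1
      refine h1.congr_of_eventuallyEq (Filter.Eventually.of_forall fun s => ?_)
      simp only [zero_mul, sub_zero, add_zero, hd0, id]
      ring) (by positivity)
  refine ⟨σ, hσ0, hσ.mono fun c hc => ⟨hc.1, ?_⟩⟩
  rw [hfac (c * σ c - c), hfac (c * σ c + c)]
  linear_combination c * hc.2

theorem mul_sqrt_eq_of_sq_mul_eq {c b k w : ℝ} (hb : 0 < b)
    (hk : c ^ 2 * w = c ^ 2 * (b ^ 2 * k)) : c * √w = c * (b * √k) := by
  rcases eq_or_ne c 0 with rfl | hc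
  · simp
  · rw [mul_left_cancel₀ (pow_ne_zero 2 hc) hk, Real.sqrt_mul (sq_nonneg b), Real.sqrt_sq hb.le]

theorem sqrt_sub_sqrt_eq_div {y z d l : ℝ} (hy : 0 < y) (hz : 0 < z) (hd : y - z = d * l) :
    √y - √z = d * (l / (√y + √z)) := by
  have hs : 0 < √y + √z := add_pos (Real.sqrt_pos.2 hy) (Real.sqrt_pos.2 hz)
  rw [← mul_div_assoc, eq_div_iff hs.ne', ← hd]
  linear_combination Real.sq_sqrt hy.le - Real.sq_sqrt hz.le

theorem HasFDerivAt.mul_of_left_eq_zero {E : Type*} [NormedAddCommGroup E] [NormedSpace ℝ E]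
    {A B : E → ℝ} {A' : E →L[ℝ] ℝ} {p : E} (hA : HasFDerivAt A A' p) (hB : DifferentiableAt ℝ B p)
    (hAp : A p = 0) : HasFDerivAt (fun q => A q * B q) (B p • A') p := by
  have h1 := hA.mul hB.hasFDerivAt
  rw [hAp, zero_smul, zero_add] at h1
  exact h1

/-- Normal form for `f(t,c) = h(t-c)·h(t+c)`: there is a smooth change of variables
`(t,c) ↦ (x(t,c), a(c))` (a diffeomorphism onto its image, i.e. smooth, injective, with
everywhere invertible differential) near `(0,0)` such that `f = (x+a)(x-a)` and
`h(t∓c) = (x∓a)·g_{1,2}(x,a)` with `g₁, g₂` smooth and nonvanishing near `(0,0)`. -/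
theorem stmt_6 (h : ℝ → ℝ) (hsm : ContDiff ℝ (⊤ : ℕ∞) h) (h0 : h 0 = 0)
    (hpos : ∀ t : ℝ, 0 < deriv h t) :
    ∃ U : Set (ℝ × ℝ), IsOpen U ∧ ((0 : ℝ), (0 : ℝ)) ∈ U ∧
      ∃ (x : ℝ × ℝ → ℝ) (a : ℝ → ℝ) (g₁ g₂ : ℝ × ℝ → ℝ) (W : Set (ℝ × ℝ)),
        ContDiffOn ℝ (⊤ : ℕ∞) x U ∧
        ContDiffOn ℝ (⊤ : ℕ∞) (fun p : ℝ × ℝ => a p.2) U ∧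
        IsOpen W ∧ ((0 : ℝ), (0 : ℝ)) ∈ W ∧
        ContDiffOn ℝ (⊤ : ℕ∞) g₁ W ∧ ContDiffOn ℝ (⊤ : ℕ∞) g₂ W ∧
        (∀ q ∈ W, g₁ q ≠ 0 ∧ g₂ q ≠ 0) ∧
        (∀ p ∈ U, (x p, a p.2) ∈ W) ∧
        Set.InjOn (fun p : ℝ × ℝ => (x p, a p.2)) U ∧
        (∀ p ∈ U, ∃ L : (ℝ × ℝ) ≃L[ℝ] (ℝ × ℝ),
          HasFDerivAt (fun p : ℝ × ℝ => (x p, a p.2))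
            (L : (ℝ × ℝ) →L[ℝ] (ℝ × ℝ)) p) ∧
        (∀ p ∈ U, h (p.1 - p.2) * h (p.1 + p.2) = (x p + a p.2) * (x p - a p.2)) ∧
        (∀ p ∈ U, h (p.1 - p.2) = (x p - a p.2) * g₁ (x p, a p.2) ∧
                   h (p.1 + p.2) = (x p + a p.2) * g₂ (x p, a p.2)) := by
  obtain ⟨H, hH, hfac, hHpos, hd0⟩ := exists_pos_factor hsm h0 hpos
  obtain ⟨K, hK, hK0, hexp⟩ := exists_second_order_remainder hsm hH hfac
  obtain ⟨Λ, hΛ, hΛeq⟩ := exists_contDiff_dividedDifference hK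
  obtain ⟨σ, hσ0, hσ⟩ := exists_critical_slope hsm hH hfac (hHpos 0).ne' hd0
  set w : ℝ × ℝ → ℝ := fun p => (1 - σ p.2 ^ 2) * (H (p.2 * σ p.2 - p.2) * H (p.2 * σ p.2 + p.2))
    with hw
  set k : ℝ × ℝ → ℝ := fun p => K (p.1, p.2 * σ p.2, p.2) with hk
  set k₁ : ℝ × ℝ → ℝ := fun p => K (p.2, p.2 * σ p.2, p.2) with hk₁
  set k₂ : ℝ × ℝ → ℝ := fun p => K (-p.2, p.2 * σ p.2, p.2) with hk₂
  set u₁ : ℝ × ℝ → ℝ := fun p => √(k p) + p.2 * (1 - σ p.2) *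
    (Λ (p.1, p.2, p.2 * σ p.2, p.2) / (√(k p) + √(k₁ p))) with hu₁
  set u₂ : ℝ × ℝ → ℝ := fun p => √(k p) - p.2 * (1 + σ p.2) *
    (Λ (p.1, -p.2, p.2 * σ p.2, p.2) / (√(k p) + √(k₂ p))) with hu₂
  set x : ℝ × ℝ → ℝ := fun p => (p.1 - p.2 * σ p.2) * √(k p) with hx
  set a : ℝ → ℝ := fun c => c * √(w (0, c)) with ha
  have hσ' : ∀ᶠ p : ℝ × ℝ in nhds (0, 0), ContDiffAt ℝ (⊤ : ℕ∞) σ p.2 ∧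
      deriv h (p.2 * σ p.2 - p.2) * h (p.2 * σ p.2 + p.2) +
        h (p.2 * σ p.2 - p.2) * deriv h (p.2 * σ p.2 + p.2) = 0 := by
    have ht : Filter.Tendsto Prod.snd (nhds ((0 : ℝ), (0 : ℝ))) (nhds (0 : ℝ)) :=
      continuous_snd.tendsto _
    exact ht.eventually hσ
  have smooth_w : ∀ p, ContDiffAt ℝ (⊤ : ℕ∞) σ p.2 →
      ContDiffAt ℝ (⊤ : ℕ∞) w p := by
    intro p hp
    simp only [hw]
    fun_prop
  have smooth_k : ∀ p, ContDiffAt ℝ (⊤ : ℕ∞) σ p.2 →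
      ContDiffAt ℝ (⊤ : ℕ∞) k p ∧ ContDiffAt ℝ (⊤ : ℕ∞) k₁ p ∧ ContDiffAt ℝ (⊤ : ℕ∞) k₂ p := by
    intro p hp
    simp only [hk, hk₁, hk₂]
    exact ⟨by fun_prop, by fun_prop, by fun_prop⟩
  have smooth_u : ∀ p, ContDiffAt ℝ (⊤ : ℕ∞) σ p.2 →
      0 < k p → 0 < k₁ p → 0 < k₂ p →
      ContDiffAt ℝ (⊤ : ℕ∞) u₁ p ∧ ContDiffAt ℝ (⊤ : ℕ∞) u₂ p := by
    intro p hp h1 h2 h3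
    obtain ⟨s1, s2, s3⟩ := smooth_k p hp
    have r1 := s1.sqrt h1.ne'
    have r2 := s2.sqrt h2.ne'
    have r3 := s3.sqrt h3.ne'
    have n1 : √(k p) + √(k₁ p) ≠ 0 := (add_pos (Real.sqrt_pos.2 h1) (Real.sqrt_pos.2 h2)).ne'
    have n2 : √(k p) + √(k₂ p) ≠ 0 := (add_pos (Real.sqrt_pos.2 h1) (Real.sqrt_pos.2 h3)).ne'
    have l1 : ContDiffAt ℝ (⊤ : ℕ∞)
        (fun p : ℝ × ℝ => Λ (p.1, p.2, p.2 * σ p.2, p.2)) p := by fun_prop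
    have l2 : ContDiffAt ℝ (⊤ : ℕ∞)
        (fun p : ℝ × ℝ => Λ (p.1, -p.2, p.2 * σ p.2, p.2)) p := by fun_prop
    have m1 : ContDiffAt ℝ (⊤ : ℕ∞) (fun p : ℝ × ℝ => p.2 * (1 - σ p.2)) p := by fun_prop
    have m2 : ContDiffAt ℝ (⊤ : ℕ∞) (fun p : ℝ × ℝ => p.2 * (1 + σ p.2)) p := by fun_prop
    exact ⟨r1.add (m1.mul (l1.div (r1.add r2) n1)), r1.sub (m2.mul (l2.div (r1.add r3) n2))⟩
  have hσ₀ := hσ'.self_of_nhds.1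
  have hσat : ContDiffAt ℝ (⊤ : ℕ∞) (fun p : ℝ × ℝ => σ p.2) (0, 0) := hσ₀.comp _ contDiffAt_snd
  have w0 : w (0, 0) = H 0 ^ 2 := by simp [hw, hσ0, sq]
  have k0 : k (0, 0) = H 0 ^ 2 := by simp [hk, hK0]
  have k₁0 : k₁ (0, 0) = H 0 ^ 2 := by simp [hk₁, hK0]
  have k₂0 : k₂ (0, 0) = H 0 ^ 2 := by simp [hk₂, hK0]
  have hH2 : 0 < H 0 ^ 2 := pow_pos (hHpos 0) 2
  have kpos : 0 < k (0, 0) := k0 ▸ hH2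
  have k₁pos : 0 < k₁ (0, 0) := k₁0 ▸ hH2
  have k₂pos : 0 < k₂ (0, 0) := k₂0 ▸ hH2
  have wpos : 0 < w (0, 0) := w0 ▸ hH2
  have u₁pos : 0 < u₁ (0, 0) := by simpa [hu₁] using Real.sqrt_pos.2 kpos
  have u₂pos : 0 < u₂ (0, 0) := by simpa [hu₂] using Real.sqrt_pos.2 kpos
  obtain ⟨sk, sk₁, sk₂⟩ := smooth_k _ hσ₀
  obtain ⟨su₁, su₂⟩ := smooth_u _ hσ₀ kpos k₁pos k₂pos
  have sw := smooth_w _ hσ₀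
  have hσlt : ∀ᶠ p : ℝ × ℝ in nhds (0, 0), |σ p.2| < 1 :=
    hσat.continuousAt.abs.eventually_lt_const (by simp [hσ0])
  have hV := hσ'.and <| hσlt.and <| (sw.continuousAt.eventually_const_lt wpos).and <|
    (sk.continuousAt.eventually_const_lt kpos).and <|
    (sk₁.continuousAt.eventually_const_lt k₁pos).and <|
    (sk₂.continuousAt.eventually_const_lt k₂pos).and <|
    (su₁.continuousAt.eventually_const_lt u₁pos).and
    (su₂.continuousAt.eventually_const_lt u₂pos)
  set V : Set (ℝ × ℝ) := {p | _} with hVdef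
  replace hV : V ∈ nhds ((0 : ℝ), (0 : ℝ)) := hV
  have smooth_x : ∀ p ∈ V, ContDiffAt ℝ (⊤ : ℕ∞) x p := by
    rintro p ⟨⟨hp, -⟩, -, -, hkp, -⟩
    have h1 : ContDiffAt ℝ (⊤ : ℕ∞) (fun p : ℝ × ℝ => p.1 - p.2 * σ p.2) p := by fun_prop
    exact h1.mul ((smooth_k p hp).1.sqrt hkp.ne')
  have smooth_a : ∀ p ∈ V, ContDiffAt ℝ (⊤ : ℕ∞) (fun p : ℝ × ℝ => a p.2) p := by
    rintro p ⟨⟨hp, -⟩, -, hwp, -⟩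
    exact contDiffAt_snd.mul ((smooth_w p hp).sqrt hwp.ne')
  have dx : HasFDerivAt x (√(k (0, 0)) • ContinuousLinearMap.fst ℝ ℝ ℝ) (0, 0) := by
    have h1 : HasFDerivAt (fun p : ℝ × ℝ => p.2 * σ p.2)
        (σ (0, 0).2 • ContinuousLinearMap.snd ℝ ℝ ℝ) (0, 0) :=
      HasFDerivAt.mul_of_left_eq_zero hasFDerivAt_snd (hσat.differentiableAt (by simp)) rfl
    have h2 : HasFDerivAt (fun p : ℝ × ℝ => p.1 - p.2 * σ p.2)
        (ContinuousLinearMap.fst ℝ ℝ ℝ) (0, 0) := by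
      have := hasFDerivAt_fst.sub h1
      rw [hσ0, zero_smul, sub_zero] at this
      exact this
    exact h2.mul_of_left_eq_zero ((sk.sqrt kpos.ne').differentiableAt (by simp)) (by simp)
  have da : HasFDerivAt (fun p : ℝ × ℝ => a p.2)
      (√(w (0, 0)) • ContinuousLinearMap.snd ℝ ℝ ℝ) (0, 0) :=
    HasFDerivAt.mul_of_left_eq_zero (B := fun p => √(w p)) hasFDerivAt_snd
      ((sw.sqrt wpos.ne').differentiableAt (by simp)) rfl
  obtain ⟨e, he, h0s, hsV, hsymm, hder⟩ := exists_openPartialHomeomorph_contDiffOn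
    (Ψ := fun p : ℝ × ℝ => (x p, a p.2)) hV
    (fun q hq => (smooth_x q hq).prodMk (smooth_a q hq)) (dx.prodMk da) (by
      rintro ⟨v, v'⟩ hv
      simpa [(Real.sqrt_pos.2 kpos).ne', (Real.sqrt_pos.2 wpos).ne'] using hv)
  have hsq : ∀ p ∈ V, ∀ t, h (t - p.2) * h (t + p.2) =
      (t - p.2 * σ p.2) ^ 2 * K (t, p.2 * σ p.2, p.2) - p.2 ^ 2 * w p := by
    rintro p ⟨⟨-, hcrit⟩, -⟩ t
    rw [hexp t (p.2 * σ p.2) p.2, hcrit, hfac (p.2 * σ p.2 - p.2), hfac (p.2 * σ p.2 + p.2)]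
    simp only [hw]
    ring
  have hxa₁ : ∀ p ∈ V, x p - a p.2 = (p.1 - p.2) * u₁ p := by
    intro p hp
    obtain ⟨-, hσp, -, hkp, hk₁p, -⟩ := id hp
    have h1 := hsq p hp p.2
    rw [sub_self, h0, zero_mul] at h1
    have h2 : p.2 * √(w p) = p.2 * ((1 - σ p.2) * √(k₁ p)) :=
      mul_sqrt_eq_of_sq_mul_eq (by linarith [(abs_lt.1 hσp).2]) (by linear_combination h1)
    have h3 := sqrt_sub_sqrt_eq_div hkp hk₁p (hΛeq p.1 p.2 (p.2 * σ p.2, p.2))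
    change (p.1 - p.2 * σ p.2) * √(k p) - p.2 * √(w p) = (p.1 - p.2) * (√(k p) +
      p.2 * (1 - σ p.2) * (Λ (p.1, p.2, p.2 * σ p.2, p.2) / (√(k p) + √(k₁ p))))
    linear_combination p.2 * (1 - σ p.2) * h3 - h2
  have hxa₂ : ∀ p ∈ V, x p + a p.2 = (p.1 + p.2) * u₂ p := by
    intro p hp
    obtain ⟨-, hσp, -, hkp, -, hk₂p, -⟩ := id hp
    have h1 := hsq p hp (-p.2)
    rw [neg_add_cancel, h0, mul_zero] at h1
    have h2 : p.2 * √(w p) = p.2 * ((1 + σ p.2) * √(k₂ p)) :=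
      mul_sqrt_eq_of_sq_mul_eq (by linarith [(abs_lt.1 hσp).1]) (by linear_combination h1)
    have h3 := sqrt_sub_sqrt_eq_div hkp hk₂p (hΛeq p.1 (-p.2) (p.2 * σ p.2, p.2))
    change (p.1 - p.2 * σ p.2) * √(k p) + p.2 * √(w p) = (p.1 + p.2) * (√(k p) -
      p.2 * (1 + σ p.2) * (Λ (p.1, -p.2, p.2 * σ p.2, p.2) / (√(k p) + √(k₂ p))))
    linear_combination -p.2 * (1 + σ p.2) * h3 + h2
  have smooth_symm : ∀ q ∈ e.target, ContDiffAt ℝ (⊤ : ℕ∞) e.symm q :=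
    fun q hq => hsymm.contDiffAt (e.open_target.mem_nhds hq)
  have hinv : ∀ p ∈ e.source, e.symm (x p, a p.2) = p := fun p hp => by
    simpa [he] using e.left_inv hp
  have hmaps : ∀ p ∈ e.source, (x p, a p.2) ∈ e.target := fun p hp => by
    simpa [he] using e.map_source hp
  have htV : ∀ q ∈ e.target, e.symm q ∈ V := fun q hq => hsV (e.map_target hq)
  refine ⟨e.source, e.open_source, h0s, x, a,
    fun q => H ((e.symm q).1 - (e.symm q).2) / u₁ (e.symm q),
    fun q => H ((e.symm q).1 + (e.symm q).2) / u₂ (e.symm q), e.target,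
    fun p hp => (smooth_x p (hsV hp)).contDiffWithinAt,
    fun p hp => (smooth_a p (hsV hp)).contDiffWithinAt, e.open_target, ?_, ?_, ?_, ?_, hmaps,
    ?_, hder, ?_, ?_⟩
  · simpa [hx, ha] using hmaps _ h0s
  · intro q hq
    obtain ⟨⟨hp, -⟩, -, -, h1, h2, h3, h4, -⟩ := htV q hq
    have hc : ContDiffAt ℝ (⊤ : ℕ∞) (fun p : ℝ × ℝ => H (p.1 - p.2) / u₁ p) (e.symm q) :=
      (by fun_prop : ContDiffAt ℝ (⊤ : ℕ∞) (fun p : ℝ × ℝ => H (p.1 - p.2)) (e.symm q)).div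
        (smooth_u _ hp h1 h2 h3).1 h4.ne'
    exact (hc.comp q (smooth_symm q hq)).contDiffWithinAt
  · intro q hq
    obtain ⟨⟨hp, -⟩, -, -, h1, h2, h3, -, h4⟩ := htV q hq
    have hc : ContDiffAt ℝ (⊤ : ℕ∞) (fun p : ℝ × ℝ => H (p.1 + p.2) / u₂ p) (e.symm q) :=
      (by fun_prop : ContDiffAt ℝ (⊤ : ℕ∞) (fun p : ℝ × ℝ => H (p.1 + p.2)) (e.symm q)).div
        (smooth_u _ hp h1 h2 h3).2 h4.ne'
    exact (hc.comp q (smooth_symm q hq)).contDiffWithinAt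
  · intro q hq
    obtain ⟨-, -, -, -, -, -, h4, h5⟩ := htV q hq
    exact ⟨(div_pos (hHpos _) h4).ne', (div_pos (hHpos _) h5).ne'⟩
  · intro p hp q hq hpq
    exact e.injOn hp hq (by simpa [he] using hpq)
  · intro p hp
    obtain ⟨-, -, hwp, hkp, -⟩ := id (hsV hp)
    rw [hsq p (hsV hp) p.1]
    change (p.1 - p.2 * σ p.2) ^ 2 * k p - p.2 ^ 2 * w p =
      ((p.1 - p.2 * σ p.2) * √(k p) + p.2 * √(w p)) * ((p.1 - p.2 * σ p.2) * √(k p) - p.2 * √(w p))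
    linear_combination p.2 ^ 2 * Real.sq_sqrt hwp.le -
      (p.1 - p.2 * σ p.2) ^ 2 * Real.sq_sqrt hkp.le
  · intro p hp
    obtain ⟨-, -, -, -, -, -, h4, h5⟩ := id (hsV hp)
    simp only [hinv p hp]
    rw [hxa₁ p (hsV hp), hxa₂ p (hsV hp), hfac (p.1 - p.2), hfac (p.1 + p.2), mul_assoc, mul_assoc,
      mul_div_cancel₀ _ h4.ne', mul_div_cancel₀ _ h5.ne']
    exact ⟨rfl, rfl⟩
end
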